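/- For ν > −1 there exists a constant C_ν such that for all t > 0 the kernel K_t(x,y) = ∫_t^∞ (s√(xy) J_ν(xs)J_ν(ys) − (2/π)cos(xs−α)cos(ys−α)) ds satisfies (∫_1^∞ ∫_1^∞ |K_t(x,y)|² dx dy)^{1/2} ≤ C_ν/t; in fact K_t(x,y) = O(1/(xyt)) uniformly for x, y ≥ 1. -/

import Mathlib

open Filter MeasureTheory Set

noncomputable section

/-- The Bessel function of the first kind of order `ν`. -/
noncomputable def besselJ (ν : ℝ) (x : ℝ) : ℝ :=
  ∑' k : ℕ, ((-1 : ℝ) ^ k / (Nat.factorial k * Real.Gamma (ν + k + 1))) *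
    (x / 2) ^ (2 * (k : ℝ) + ν)

/-- The improper integral
`K_t(x,y) = ∫_t^∞ (s √(xy) J_ν(xs) J_ν(ys) - (2/π) cos(xs - α) cos(ys - α)) ds`,
with `α = πν/2 + π/4`, defined as a limit of proper integrals. -/
def besselTailKernel (ν t x y : ℝ) : ℝ :=
  limUnder atTop
    (fun S : ℝ => ∫ s in t..S,
      (s * Real.sqrt (x * y) * besselJ ν (x * s) * besselJ ν (y * s) -
        2 * Real.cos (x * s - (Real.pi * ν / 2 + Real.pi / 4)) *
          Real.cos (y * s - (Real.pi * ν / 2 + Real.pi / 4)) / Real.pi))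

/-- The entire series with `J_ν(z) = (z/2)^ν Ψ_ν(z²/4)`. -/
def psiCoef (ν : ℝ) (k : ℕ) : ℝ := (-1 : ℝ) ^ k / (Nat.factorial k * Real.Gamma (ν + k + 1))

def Psi (ν q : ℝ) : ℝ := ∑' k : ℕ, psiCoef ν k * q ^ k

lemma psiCoef_bound (ν : ℝ) (hν : -1 < ν) :
    ∃ M : ℝ, 0 ≤ M ∧ ∀ k : ℕ, |psiCoef ν k| ≤ M / (Nat.factorial k) := by
  have hpos : ∀ k : ℕ, 0 < Real.Gamma (ν + k + 1) := fun k =>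
    Real.Gamma_pos_of_pos (by have : (0:ℝ) ≤ k := Nat.cast_nonneg k
                              linarith)
  have hstep : ∀ k : ℕ, Real.Gamma (ν + 1 + 1) ≤ Real.Gamma (ν + (k + 1 : ℕ) + 1) := by
    intro k
    induction k with
    | zero => simp
    | succ k ih =>
      refine ih.trans ?_
      have h0 : (0:ℝ) ≤ k := Nat.cast_nonneg k
      have : ν + ((k + 1 + 1 : ℕ) : ℝ) + 1 = (ν + ((k + 1 : ℕ) : ℝ) + 1) + 1 := by push_cast; ring
      rw [this, Real.Gamma_add_one (s := ν + ((k + 1 : ℕ) : ℝ) + 1) (by push_cast; linarith)]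
      have h1 := hpos (k+1)
      have : 1 ≤ ν + ((k + 1 : ℕ) : ℝ) + 1 := by push_cast; linarith
      exact le_mul_of_one_le_left h1.le this
  have hp0 := hpos 0
  have hp1 := hpos 1
  simp only [Nat.cast_zero, add_zero, Nat.cast_one] at hp0 hp1
  refine ⟨1 / Real.Gamma (ν + 1) + 1 / Real.Gamma (ν + 1 + 1), by positivity, ?_⟩
  intro k
  have hk := hpos k
  have hf : (0:ℝ) < Nat.factorial k := by positivity
  unfold psiCoef
  rw [abs_div, abs_pow, abs_neg, abs_one, one_pow, abs_of_pos (mul_pos hf hk), mul_comm,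
    ← div_div]
  refine div_le_div_of_nonneg_right ?_ hf.le
  rcases k with _ | k
  · simp only [Nat.cast_zero, add_zero]
    have : 0 ≤ 1 / Real.Gamma (ν + 1 + 1) := by positivity
    linarith
  · have : 1 / Real.Gamma (ν + (k + 1 : ℕ) + 1) ≤ 1 / Real.Gamma (ν + 1 + 1) :=
      one_div_le_one_div_of_le hp1 (hstep k)
    have : 0 ≤ 1 / Real.Gamma (ν + 1) := by positivity
    linarith

lemma summable_psi (ν : ℝ) (hν : -1 < ν) (q : ℝ) : Summable (fun k => psiCoef ν k * q ^ k) := by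
  obtain ⟨M, hM, h⟩ := psiCoef_bound ν hν
  refine Summable.of_norm_bounded (g := fun k => M * (|q| ^ k / (Nat.factorial k)))
    ((Real.summable_pow_div_factorial |q|).mul_left M) ?_
  intro k
  rw [Real.norm_eq_abs, abs_mul, abs_pow]
  calc _ ≤ M / (Nat.factorial k) * |q| ^ k := by gcongr; exact h k
    _ = _ := by ring

lemma psiCoef_succ (ν : ℝ) (k : ℕ) : psiCoef ν (k + 1) * (k + 1) = - psiCoef (ν + 1) k := by
  unfold psiCoef
  have : ν + ((k + 1 : ℕ) : ℝ) + 1 = ν + 1 + k + 1 := by push_cast; ring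
  rw [this, Nat.factorial_succ, pow_succ]
  push_cast
  have h1 : ((k : ℝ) + 1) ≠ 0 := by positivity
  have h2 : (Nat.factorial k : ℝ) ≠ 0 := by positivity
  by_cases hG : Real.Gamma (ν + 1 + k + 1) = 0
  · simp [hG]
  · field_simp

lemma hasDerivAt_psi (ν : ℝ) (hν : -1 < ν) (q : ℝ) :
    HasDerivAt (Psi ν) (- Psi (ν + 1) q) q := by
  obtain ⟨M, hM, h⟩ := psiCoef_bound ν hν
  set R := |q| + 1 with hR
  have hR0 : 0 ≤ R := by positivity
  have hsum : Summable (fun k : ℕ => M / (Nat.factorial k) * (k * R ^ (k - 1))) := by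
    rw [← summable_nat_add_iff 1]
    refine ((Real.summable_pow_div_factorial R).mul_left M).congr ?_
    intro k
    rw [Nat.factorial_succ]
    push_cast
    have h1 : ((k : ℝ) + 1) ≠ 0 := by positivity
    have h2 : (Nat.factorial k : ℝ) ≠ 0 := by positivity
    field_simp
  have key := hasDerivAt_tsum_of_isPreconnected (𝕜 := ℝ) (F := ℝ) hsum
    (g := fun k y => psiCoef ν k * y ^ k) (g' := fun k y => psiCoef ν k * (k * y ^ (k - 1)))
    (t := Metric.ball 0 R) (y₀ := q) (y := q) Metric.isOpen_ball
    (convex_ball (0:ℝ) R).isPreconnected ?_ ?_ ?_ (summable_psi ν hν q) ?_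
  · refine key.congr_deriv ?_
    symm
    have h0 : Summable (fun k : ℕ => psiCoef ν k * (k * q ^ (k - 1))) := by
      refine Summable.of_norm_bounded hsum ?_
      intro k
      rw [Real.norm_eq_abs, abs_mul, abs_mul, abs_pow, Nat.abs_cast]
      gcongr
      · exact h k
      · linarith
    rw [h0.tsum_eq_zero_add, Psi, ← tsum_neg]
    simp only [Nat.cast_zero, zero_mul, mul_zero, zero_add, Nat.add_sub_cancel]
    congr 1
    ext k
    rw [← neg_mul, ← psiCoef_succ]
    push_cast; ring
  · intro k y _
    exact (hasDerivAt_pow k y).const_mul _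
  · intro k y hy
    rw [mem_ball_zero_iff, Real.norm_eq_abs] at hy
    rw [Real.norm_eq_abs, abs_mul, abs_mul, abs_pow, Nat.abs_cast]
    gcongr
    · exact h k
  · rw [mem_ball_zero_iff, Real.norm_eq_abs]; linarith
  · rw [mem_ball_zero_iff, Real.norm_eq_abs]; linarith

lemma psi_rec (ν : ℝ) (hν : -1 < ν) (q : ℝ) :
    Psi ν q = (ν + 1) * Psi (ν + 1) q - q * Psi (ν + 2) q := by
  have hc : ∀ k, psiCoef ν k * q ^ k = (ν + 1) * (psiCoef (ν + 1) k * q ^ k)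
      + psiCoef (ν + 1) k * (k * q ^ k) := by
    intro k
    have h0 : (0:ℝ) ≤ k := Nat.cast_nonneg k
    have : psiCoef ν k = (ν + k + 1) * psiCoef (ν + 1) k := by
      unfold psiCoef
      have h3 : ν + 1 + k + 1 = (ν + k + 1) + 1 := by ring
      have h4 : ν + k + 1 ≠ 0 := by linarith
      rw [h3, Real.Gamma_add_one h4]
      have := (Real.Gamma_pos_of_pos (show 0 < ν + k + 1 by linarith)).ne'
      field_simp
    rw [this]; ring
  have hs0 := summable_psi ν hν q
  have hs1 := summable_psi (ν + 1) (by linarith) q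
  have hs2 : Summable (fun k : ℕ => psiCoef (ν + 1) k * (k * q ^ k)) := by
    refine (hs0.sub (hs1.mul_left (ν + 1))).congr ?_
    intro k; rw [hc k]; ring
  unfold Psi
  rw [tsum_congr hc, (hs1.mul_left _).tsum_add hs2, tsum_mul_left, hs2.tsum_eq_zero_add,
    sub_eq_add_neg, ← tsum_mul_left (a := q), ← tsum_neg]
  congr 1
  simp only [Nat.cast_zero, zero_mul, mul_zero, zero_add]
  congr 1
  ext k
  have := psiCoef_succ (ν + 1) k
  rw [show ν + 1 + 1 = ν + 2 by ring] at this
  push_cast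
  calc _ = (psiCoef (ν + 1) (k + 1) * (k + 1)) * q ^ (k + 1) := by ring
    _ = _ := by rw [this]; ring

/-- `fB ν z = √z J_ν(z)`. -/
def fB (ν z : ℝ) : ℝ := z ^ (1 / 2 : ℝ) * (z / 2) ^ ν * Psi ν (z ^ 2 / 4)

lemma fB_eq (ν z : ℝ) (hz : 0 < z) : Real.sqrt z * besselJ ν z = fB ν z := by
  unfold fB besselJ Psi
  rw [Real.sqrt_eq_rpow, mul_assoc]
  congr 1
  rw [← tsum_mul_left]
  congr 1
  ext k
  have h2 : 0 < z / 2 := by positivity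
  rw [Real.rpow_add h2, show (2 * (k:ℝ)) = ((2 * k : ℕ) : ℝ) by push_cast; ring,
    Real.rpow_natCast, pow_mul, psiCoef, show (z / 2) ^ 2 = z ^ 2 / 4 by ring]
  ring

lemma fB_rec (ν z : ℝ) (hν : -1 < ν) (hz : 0 < z) :
    fB (ν + 2) z = 2 * (ν + 1) / z * fB (ν + 1) z - fB ν z := by
  unfold fB
  have h2 : 0 < z / 2 := by positivity
  rw [psi_rec ν hν, Real.rpow_add h2, Real.rpow_add h2, Real.rpow_one,
    show (2:ℝ) = ((2:ℕ):ℝ) by norm_num, Real.rpow_natCast]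
  push_cast
  field_simp
  ring

lemma hasDerivAt_fB (ν z : ℝ) (hν : -1 < ν) (hz : 0 < z) :
    HasDerivAt (fB ν) ((ν + 1 / 2) / z * fB ν z - fB (ν + 1) z) z := by
  have h2 : 0 < z / 2 := by positivity
  have d1 : HasDerivAt (fun z : ℝ => z ^ (1 / 2 : ℝ)) (1 * (1 / 2 : ℝ) * z ^ ((1 / 2 : ℝ) - 1)) z :=
    (hasDerivAt_id z).rpow_const (Or.inl hz.ne')
  have d2 : HasDerivAt (fun z : ℝ => (z / 2) ^ ν) ((1 / 2) * ν * (z / 2) ^ (ν - 1)) z :=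
    ((hasDerivAt_id z).div_const 2).rpow_const (Or.inl h2.ne')
  have d3 : HasDerivAt (fun z : ℝ => Psi ν (z ^ 2 / 4)) (- Psi (ν + 1) (z ^ 2 / 4) * (z / 2)) z := by
    have : HasDerivAt (fun z : ℝ => z ^ 2 / 4) (z / 2) z := by
      refine ((hasDerivAt_pow 2 z).div_const 4).congr_deriv ?_
      norm_num; ring
    exact (hasDerivAt_psi ν hν (z ^ 2 / 4)).comp z this
  refine ((d1.mul d2).mul d3).congr_deriv ?_
  unfold fB
  simp only [Pi.mul_apply]
  rw [Real.rpow_sub_one hz.ne', Real.rpow_sub_one h2.ne', Real.rpow_add_one h2.ne']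
  field_simp
  ring

lemma hasDerivAt_fB_succ (ν z : ℝ) (hν : -1 < ν) (hz : 0 < z) :
    HasDerivAt (fB (ν + 1)) (fB ν z - (ν + 1 / 2) / z * fB (ν + 1) z) z := by
  refine (hasDerivAt_fB (ν + 1) z (by linarith) hz).congr_deriv ?_
  rw [show ν + 1 + 1 = ν + 2 by ring, fB_rec ν z hν hz]
  field_simp
  ring

/-- The derivative of `fB`. -/
def fB1 (ν z : ℝ) : ℝ := (ν + 1 / 2) / z * fB ν z - fB (ν + 1) z

lemma hasDerivAt_fB1 (ν z : ℝ) (hν : -1 < ν) (hz : 0 < z) :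
    HasDerivAt (fB1 ν) (- fB ν z + (ν ^ 2 - 1 / 4) * fB ν z / z ^ 2) z := by
  have h1 := hasDerivAt_fB ν z hν hz
  have h2 := hasDerivAt_fB_succ ν z hν hz
  have h3 : HasDerivAt (fun z : ℝ => (ν + 1 / 2) / z) (-(ν + 1 / 2) / z ^ 2) z := by
    refine ((hasDerivAt_inv hz.ne').const_mul (ν + 1 / 2)).congr_deriv ?_
    field_simp
  refine ((h3.mul h1).sub h2).congr_deriv ?_
  field_simp
  ring

lemma continuous_psi (ν : ℝ) (hν : -1 < ν) : Continuous (Psi ν) :=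
  continuous_iff_continuousAt.2 fun q => (hasDerivAt_psi ν hν q).continuousAt

lemma continuousOn_fB (ν : ℝ) (hν : -1 < ν) : ContinuousOn (fB ν) (Ioi 0) :=
  fun z hz => (hasDerivAt_fB ν z hν hz).continuousAt.continuousWithinAt

lemma continuousOn_fB1 (ν : ℝ) (hν : -1 < ν) : ContinuousOn (fB1 ν) (Ioi 0) :=
  fun z hz => (hasDerivAt_fB1 ν z hν hz).continuousAt.continuousWithinAt

lemma psi_bdd (ν : ℝ) (hν : -1 < ν) :
    ∃ M : ℝ, 0 ≤ M ∧ ∀ z, 0 < z → z ≤ 1 → |Psi ν (z ^ 2 / 4)| ≤ M := by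
  obtain ⟨M, hM⟩ := (isCompact_Icc (a := (0:ℝ)) (b := 1)).exists_bound_of_continuousOn
    (continuous_psi ν hν).continuousOn
  refine ⟨M, (norm_nonneg _).trans (hM 0 (by simp)), fun z h0 h1 => hM _ ⟨by positivity, by nlinarith⟩⟩

/-- small-argument bound -/
lemma fB_small (ν : ℝ) (hν : -1 < ν) :
    ∃ M : ℝ, 0 ≤ M ∧ ∀ z, 0 < z → z ≤ 1 → |fB ν z| ≤ M * z ^ (ν + 1 / 2) := by
  obtain ⟨M, hM0, hM⟩ := psi_bdd ν hν
  refine ⟨(1/2) ^ ν * M, by positivity, fun z h0 h1 => ?_⟩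
  have : fB ν z = (1/2) ^ ν * z ^ (ν + 1/2) * Psi ν (z ^ 2 / 4) := by
    unfold fB
    rw [show z / 2 = (1/2) * z by ring, Real.mul_rpow (by norm_num) h0.le, Real.rpow_add h0]
    ring
  rw [this, abs_mul, abs_of_nonneg (by positivity)]
  calc _ ≤ (1/2) ^ ν * z ^ (ν + 1/2) * M := by gcongr; exact hM z h0 h1
    _ = _ := by ring
/-- If `‖v'‖ ≤ C n / z^(n+1)` on `[1,∞)` then `v` has a limit at rate `C / z^n`. -/
lemma limit_rate (v v' : ℝ → ℂ) (n : ℕ) (hn : 0 < n) (C : ℝ)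
    (hv : ∀ z, 1 ≤ z → HasDerivAt v (v' z) z)
    (hb : ∀ z, 1 ≤ z → ‖v' z‖ ≤ C * (n / z ^ (n + 1))) :
    ∃ L : ℂ, Tendsto v atTop (nhds L) ∧ ∀ z, 1 ≤ z → ‖v z - L‖ ≤ C / z ^ n := by
  have hC : 0 ≤ C := by
    have := (norm_nonneg _).trans (hb 1 le_rfl)
    simp only [one_pow, div_one] at this
    have hn' : (0:ℝ) < n := by exact_mod_cast hn
    nlinarith
  have key : ∀ z w, 1 ≤ z → z ≤ w → ‖v w - v z‖ ≤ C / z ^ n := by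
    intro z w hz hzw
    have hB : ∀ x, 1 ≤ x → HasDerivAt (fun x : ℝ => C * ((z ^ n)⁻¹ - (x ^ n)⁻¹))
        (C * (n / x ^ (n + 1))) x := by
      intro x hx
      have hx0 : x ≠ 0 := by linarith
      have h1 := ((hasDerivAt_pow n x).inv (pow_ne_zero n hx0)).const_sub ((z ^ n)⁻¹)
      refine (h1.const_mul C).congr_deriv ?_
      obtain ⟨m, rfl⟩ : ∃ m, n = m + 1 := ⟨n - 1, by omega⟩
      simp only [Nat.add_sub_cancel]
      field_simp
      ring
    have := image_norm_le_of_norm_deriv_right_le_deriv_boundary' (a := z) (b := w)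
      (f := fun x => v x - v z) (f' := v')
      (fun x hx => ((hv x (hz.trans hx.1)).sub_const _).continuousAt.continuousWithinAt)
      (fun x hx => ((hv x (hz.trans hx.1)).sub_const _).hasDerivWithinAt)
      (B := fun x : ℝ => C * ((z ^ n)⁻¹ - (x ^ n)⁻¹)) (B' := fun x => C * (n / x ^ (n + 1)))
      (by simp)
      (fun x hx => (hB x (hz.trans hx.1)).continuousAt.continuousWithinAt)
      (fun x hx => (hB x (hz.trans hx.1)).hasDerivWithinAt)
      (fun x hx => hb x (hz.trans hx.1)) (x := w) ⟨hzw, le_rfl⟩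
    refine this.trans ?_
    have hw0 : 0 < w := by linarith
    have hz0 : 0 < z := by linarith
    have : 0 ≤ (w ^ n)⁻¹ := by positivity
    rw [div_eq_mul_inv]
    gcongr
    linarith
  have htend : Tendsto (fun z : ℝ => C / z ^ n) atTop (nhds 0) :=
    tendsto_const_nhds.div_atTop (tendsto_pow_atTop hn.ne')
  have hcau : CauchySeq v := by
    rw [Metric.cauchySeq_iff']
    intro ε hε
    obtain ⟨N, hN1, hN⟩ := ((eventually_ge_atTop (1:ℝ)).and (htend.eventually (gt_mem_nhds hε))).exists
    exact ⟨N, fun w hw => by rw [dist_eq_norm]; exact (key N w hN1 hw).trans_lt hN⟩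
  obtain ⟨L, hL⟩ := cauchySeq_tendsto_of_complete hcau
  refine ⟨L, hL, fun z hz => ?_⟩
  have h2 : Tendsto (fun w => ‖v w - v z‖) atTop (nhds ‖L - v z‖) :=
    ((show Tendsto v atTop (nhds L) from hL).sub_const _).norm
  rw [norm_sub_rev]
  exact le_of_tendsto h2 (by filter_upwards [eventually_ge_atTop z] with w hw using key z w hz hw)

lemma ode_bdd (f f1 : ℝ → ℝ) (μ : ℝ) (hf : ∀ z, 0 < z → HasDerivAt f (f1 z) z)
    (hf1 : ∀ z, 0 < z → HasDerivAt f1 (- f z + μ * f z / z ^ 2) z) :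
    ∃ M, 0 ≤ M ∧ ∀ z, 1 ≤ z → |f z| ≤ M := by
  have hd : ∀ z, 0 < z → HasDerivAt (fun z => (f z ^ 2 + f1 z ^ 2) * Real.exp (|μ| * z⁻¹))
      ((2 * f z * f1 z + 2 * f1 z * (- f z + μ * f z / z ^ 2)) * Real.exp (|μ| * z⁻¹)
        + (f z ^ 2 + f1 z ^ 2) * (Real.exp (|μ| * z⁻¹) * (|μ| * (-(z ^ 2)⁻¹)))) z := by
    intro z hz
    have h1 := ((hf z hz).pow 2).add ((hf1 z hz).pow 2)
    have h2 := ((hasDerivAt_inv hz.ne').const_mul |μ|).exp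
    refine (h1.mul h2).congr_deriv ?_
    simp
  have hanti : AntitoneOn (fun z => (f z ^ 2 + f1 z ^ 2) * Real.exp (|μ| * z⁻¹)) (Ici 1) := by
    refine antitoneOn_of_hasDerivWithinAt_nonpos (convex_Ici 1)
      (fun z hz => (hd z (by linarith [mem_Ici.1 hz])).continuousAt.continuousWithinAt)
      (fun z hz => (hd z ?_).hasDerivWithinAt) ?_
    · rw [interior_Ici] at hz; linarith [mem_Ioi.1 hz]
    · intro z hz
      rw [interior_Ici] at hz
      have hz0 : 0 < z := by linarith [mem_Ioi.1 hz]
      have : (2 * f z * f1 z + 2 * f1 z * (- f z + μ * f z / z ^ 2)) * Real.exp (|μ| * z⁻¹)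
        + (f z ^ 2 + f1 z ^ 2) * (Real.exp (|μ| * z⁻¹) * (|μ| * (-(z ^ 2)⁻¹)))
        = -(Real.exp (|μ| * z⁻¹) * (z ^ 2)⁻¹ *
          (|μ| * (f z ^ 2 + f1 z ^ 2) - μ * (2 * f z * f1 z))) := by
        field_simp
        ring
      rw [this, neg_nonpos]
      refine mul_nonneg (by positivity) ?_
      have h3 : μ * (2 * f z * f1 z) ≤ |μ| * |2 * f z * f1 z| := by
        rw [← abs_mul]; exact le_abs_self _
      have h4 : |2 * f z * f1 z| ≤ f z ^ 2 + f1 z ^ 2 := by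
        rw [abs_le]; constructor <;> nlinarith [sq_nonneg (f z + f1 z), sq_nonneg (f z - f1 z)]
      nlinarith [abs_nonneg μ]
  refine ⟨Real.sqrt ((f 1 ^ 2 + f1 1 ^ 2) * Real.exp (|μ| * 1⁻¹)), Real.sqrt_nonneg _, fun z hz => ?_⟩
  have h5 := hanti (mem_Ici.2 le_rfl) (mem_Ici.2 hz) hz
  refine Real.abs_le_sqrt (le_trans ?_ h5)
  have hz0 : 0 < z := by linarith
  have : 1 ≤ Real.exp (|μ| * z⁻¹) := Real.one_le_exp (by positivity)
  simp only
  nlinarith [sq_nonneg (f z), sq_nonneg (f1 z)]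

open Complex in
lemma ode_asymp (f f1 : ℝ → ℝ) (μ : ℝ) (hf : ∀ z, 0 < z → HasDerivAt f (f1 z) z)
    (hf1 : ∀ z, 0 < z → HasDerivAt f1 (- f z + μ * f z / z ^ 2) z) :
    ∃ a b C : ℝ, 0 ≤ C ∧ ∀ z, 1 ≤ z →
      |f z - (a * Real.cos z + b * Real.sin z)| ≤ C / z ∧
      |f1 z - (- a * Real.sin z + b * Real.cos z)
        + μ / 2 * (a * Real.cos z + b * Real.sin z) / z| ≤ C / z ^ 2 := by
  obtain ⟨M, hM0, hM⟩ := ode_bdd f f1 μ hf hf1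
  set u : ℝ → ℂ := fun z => cexp (z * I) * (f z + f1 z * I) with hu
  have hexp : ∀ z : ℝ, HasDerivAt (fun z : ℝ => cexp (z * I)) (cexp (z * I) * I) z := by
    intro z
    have h1 : HasDerivAt (fun z : ℝ => (z : ℂ) * I) (1 * I) z :=
      (hasDerivAt_id z).ofReal_comp.mul_const I
    simpa using h1.cexp
  have hud : ∀ z : ℝ, 1 ≤ z → HasDerivAt u (I * μ * cexp (z * I) * f z / z ^ 2) z := by
    intro z hz
    have hz0 : 0 < z := by linarith
    have h1 := (hexp z).mul ((hf z hz0).ofReal_comp.add ((hf1 z hz0).ofReal_comp.mul_const I))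
    refine h1.congr_deriv ?_
    have : (z:ℂ) ≠ 0 := by exact_mod_cast hz0.ne'
    push_cast
    field_simp
    simp only [Pi.add_apply]
    ring_nf
    simp only [I_sq]
    ring
  have hnexp : ∀ z : ℝ, ‖cexp (z * I)‖ = 1 := fun z => norm_exp_ofReal_mul_I z
  obtain ⟨U, hUt, hU⟩ := limit_rate u _ 1 one_pos (|μ| * M) hud (by
    intro z hz
    have hz0 : 0 < z := by linarith
    rw [norm_div, norm_mul, norm_mul, norm_mul, hnexp, norm_I, norm_pow, norm_real, norm_real, norm_real]
    simp only [Real.norm_eq_abs, sq_abs]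
    have := hM z hz
    rw [Nat.cast_one, mul_one_div, one_mul, mul_one]
    gcongr)
  -- f = Re (e^{-iz} u)
  have hfu : ∀ z : ℝ, (f z : ℂ) + f1 z * I = cexp (-(z * I)) * u z := by
    intro z
    rw [hu]; simp only
    rw [← mul_assoc, ← Complex.exp_add]; simp
  have hcU : ∀ z : ℝ, cexp (-(z * I)) * U =
      ((U.re * Real.cos z + U.im * Real.sin z : ℝ) : ℂ)
      + ((-U.re * Real.sin z + U.im * Real.cos z : ℝ) : ℂ) * I := by
    intro z
    rw [← neg_mul, Complex.exp_mul_I, Complex.cos_neg, Complex.sin_neg, ← ofReal_cos, ← ofReal_sin]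
    apply Complex.ext <;> simp <;> ring
  have hnexp' : ∀ z : ℝ, ‖cexp (-(z * I))‖ = 1 := fun z => by
    rw [← neg_mul, ← ofReal_neg]; exact norm_exp_ofReal_mul_I _
  have he : ∀ z, 1 ≤ z → |f z - (U.re * Real.cos z + U.im * Real.sin z)| ≤ |μ| * M / z := by
    intro z hz
    have h1 : ‖cexp (-(z * I)) * (u z - U)‖ ≤ |μ| * M / z := by
      rw [norm_mul, hnexp', one_mul]; simpa using hU z hz
    refine le_trans ?_ h1
    refine le_trans (le_of_eq ?_) (abs_re_le_norm _)
    rw [mul_sub, ← hfu, hcU]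
    simp only [add_re, sub_re, mul_re, ofReal_re, ofReal_im, I_re, I_im]
    ring_nf
  set Ub : ℂ := (starRingEnd ℂ) U with hUb
  set D : ℝ := |μ| * (|μ| * M) + |μ| * ‖U‖ with hD
  -- second order corrected function
  set v : ℝ → ℂ := fun z => u z + I * μ * U / 2 * ((z:ℂ)⁻¹) - μ / 4 * Ub * (cexp (z * I) * cexp (z * I)) * ((z:ℂ)⁻¹) ^ 2 with hv
  have hvd : ∀ z : ℝ, 1 ≤ z → HasDerivAt v (I * μ * cexp (z * I) * (f z - (U.re * Real.cos z + U.im * Real.sin z : ℝ)) / z ^ 2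
      + μ / 2 * Ub * (cexp (z * I) * cexp (z * I)) / z ^ 3) z := by
    intro z hz
    have hz0 : (z:ℂ) ≠ 0 := by exact_mod_cast (by linarith : z ≠ 0)
    have hinv : HasDerivAt (fun z : ℝ => (z:ℂ)⁻¹) (-((z:ℂ) ^ 2)⁻¹) z := by
      have h1 := (hasDerivAt_id z).ofReal_comp.inv (by simpa using hz0)
      refine h1.congr_deriv ?_
      simp
      field_simp
    have h1 := ((hud z hz).add (hinv.const_mul (I * μ * U / 2))).sub
      ((((hexp z).mul (hexp z)).const_mul (μ / 4 * Ub)).mul (hinv.pow 2))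
    have hsplit : ((U.re * Real.cos z + U.im * Real.sin z : ℝ) : ℂ)
        = (cexp (-(z * I)) * U + cexp (z * I) * Ub) / 2 := by
      rw [hcU, Complex.exp_mul_I, ← ofReal_cos, ← ofReal_sin, hUb]
      apply Complex.ext <;> simp <;> ring
    refine h1.congr_deriv ?_
    have hee : cexp (z * I) * cexp (-(z * I)) = 1 := by rw [← Complex.exp_add]; simp
    have hX : I * μ * cexp (z * I) * (f z - (U.re * Real.cos z + U.im * Real.sin z : ℝ)) / z ^ 2 =
        I * μ * cexp (z * I) * f z / z ^ 2 - I * μ * U / 2 / z ^ 2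
         - I * μ * (cexp (z * I) * cexp (z * I)) * Ub / 2 / z ^ 2 := by
      rw [hsplit]
      linear_combination (- I * μ * U / 2 / z ^ 2) * hee
    rw [hX]
    simp only [Nat.cast_ofNat, Nat.add_one_sub_one, pow_one, Pi.mul_apply, Pi.pow_apply]
    field_simp
    ring
  obtain ⟨L, hL, hLb⟩ := limit_rate v _ 2 two_pos D hvd (by
    intro z hz
    have hz0 : 0 < z := by linarith
    have h1 := he z hz
    refine (norm_add_le _ _).trans ?_
    rw [norm_div, norm_div, norm_mul, norm_mul, norm_mul, norm_mul, norm_mul, norm_mul, hnexp, norm_I, norm_pow,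
      norm_pow, ← ofReal_sub, norm_real, norm_real, norm_real, norm_div, norm_real, hUb, RCLike.norm_conj]
    simp only [Real.norm_eq_abs, abs_of_pos hz0, norm_ofNat]
    calc _ ≤ 1 * |μ| * 1 * (|μ| * M / z) / z ^ 2 + |μ| / 2 * ‖U‖ * (1 * 1) / z ^ 3 := by gcongr
      _ = (|μ| * (|μ| * M) + |μ| * ‖U‖ / 2) / z ^ 3 := by field_simp
      _ ≤ (2 * D) / z ^ 3 := by
        gcongr
        rw [hD]
        have : 0 ≤ |μ| * (|μ| * M) := by positivity
        have : 0 ≤ |μ| * ‖U‖ := by positivity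
        linarith
      _ = _ := by push_cast; ring)
  have hinv0 : Tendsto (fun z : ℝ => (z:ℂ)⁻¹) atTop (nhds 0) := by
    rw [tendsto_zero_iff_norm_tendsto_zero]
    simp only [norm_inv, norm_real, Real.norm_eq_abs]
    exact tendsto_inv_atTop_zero.comp tendsto_abs_atTop_atTop
  have hLU : L = U := by
    refine tendsto_nhds_unique hL ?_
    have h1 : Tendsto (fun z : ℝ => μ / 4 * Ub * (cexp (z * I) * cexp (z * I)) * ((z:ℂ)⁻¹) ^ 2) atTop (nhds 0) := by
      rw [tendsto_zero_iff_norm_tendsto_zero]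
      have h2 := ((hinv0.norm).pow 2).const_mul (‖(μ / 4 * Ub : ℂ)‖)
      simp only [norm_zero, ne_eq, OfNat.ofNat_ne_zero, not_false_eq_true, zero_pow, mul_zero] at h2
      refine h2.congr fun z => ?_
      rw [norm_mul (_ * _) (_ ^ 2), norm_mul (_ * _) (_ * _), norm_mul (cexp _), hnexp, norm_pow]
      ring
    have h3 := (hUt.add (hinv0.const_mul (I * μ * U / 2))).sub h1
    simp only [mul_zero, add_zero, sub_zero] at h3
    exact h3
  rw [hLU] at hLb
  refine ⟨U.re, U.im, |μ| * M + D + |μ| / 4 * ‖U‖, by positivity, fun z hz => ⟨(he z hz).trans ?_, ?_⟩⟩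
  · have hz0 : 0 < z := by linarith
    gcongr
    have : 0 ≤ D := by positivity
    have : 0 ≤ |μ| / 4 * ‖U‖ := by positivity
    linarith
  · have hz0 : 0 < z := by linarith
    have h1 : ‖cexp (-(z * I)) * (u z - U + I * μ * U / 2 * (z:ℂ)⁻¹)‖ ≤ D / z ^ 2 + |μ| / 4 * ‖U‖ / z ^ 2 := by
      rw [norm_mul, hnexp', one_mul]
      have : u z - U + I * μ * U / 2 * (z:ℂ)⁻¹ =
        (v z - U) + μ / 4 * Ub * (cexp (z * I) * cexp (z * I)) * ((z:ℂ)⁻¹) ^ 2 := by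
        rw [hv]; ring
      rw [this]
      refine (norm_add_le _ _).trans (add_le_add (hLb z hz) (le_of_eq ?_))
      rw [norm_mul, norm_mul, norm_mul, norm_mul, hnexp, norm_pow, norm_inv, norm_div, norm_real, norm_real, hUb, RCLike.norm_conj]
      simp only [Real.norm_eq_abs, abs_of_pos hz0, norm_ofNat]
      field_simp
    have h2 := (abs_im_le_norm _).trans h1
    have h3 : cexp (-(z * I)) * (u z - U + I * μ * U / 2 * (z:ℂ)⁻¹)
        = cexp (-(z * I)) * u z - cexp (-(z * I)) * U
          + ((μ / 2 / z : ℝ) : ℂ) * I * (cexp (-(z * I)) * U) := by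
      push_cast; ring
    rw [h3, ← hfu, hcU] at h2
    have h4 : (↑(f z) + ↑(f1 z) * I -
          (((U.re * Real.cos z + U.im * Real.sin z : ℝ) : ℂ) + ((-U.re * Real.sin z + U.im * Real.cos z : ℝ) : ℂ) * I) +
        ((μ / 2 / z : ℝ) : ℂ) * I *
          (((U.re * Real.cos z + U.im * Real.sin z : ℝ) : ℂ) + ((-U.re * Real.sin z + U.im * Real.cos z : ℝ) : ℂ) * I)).im
        = f1 z - (- U.re * Real.sin z + U.im * Real.cos z)
        + μ / 2 * (U.re * Real.cos z + U.im * Real.sin z) / z := by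
      generalize U.re * Real.cos z + U.im * Real.sin z = A
      generalize -U.re * Real.sin z + U.im * Real.cos z = B
      simp only [add_im, sub_im, mul_im, mul_re, ofReal_re, ofReal_im, I_re, I_im, add_re]
      ring
    rw [h4] at h2
    refine h2.trans ?_
    rw [← add_div]
    gcongr
    have : 0 ≤ |μ| * M := by positivity
    linarith
lemma fB_bdd (ν : ℝ) (hν : -1 / 2 ≤ ν) : ∃ M, 0 ≤ M ∧ ∀ z, 0 < z → |fB ν z| ≤ M := by
  have hν' : -1 < ν := by linarith
  obtain ⟨M1, h10, h1⟩ := fB_small ν hν'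
  obtain ⟨M2, h20, h2⟩ := ode_bdd (fB ν) (fB1 ν) _ (fun z hz => hasDerivAt_fB ν z hν' hz)
    (fun z hz => hasDerivAt_fB1 ν z hν' hz)
  refine ⟨M1 + M2, by positivity, fun z hz => ?_⟩
  rcases le_total z 1 with h | h
  · have := h1 z hz h
    have h3 : z ^ (ν + 1 / 2) ≤ 1 := Real.rpow_le_one hz.le h (by linarith)
    nlinarith
  · linarith [h2 z h]

open Complex in
lemma lap_int (h : ℝ → ℂ) (hc : ContinuousOn h (Ioi 0)) (s M : ℝ) (hs : -1 < s)
    (hb : ∀ z, 0 < z → ‖h z‖ ≤ M * z ^ s) (p : ℂ) (hp : 0 < p.re) :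
    IntegrableOn (fun z : ℝ => cexp (-(p * z)) * h z) (Ioi 0) ∧
    ‖∫ z : ℝ in Ioi 0, cexp (-(p * z)) * h z‖ ≤ M * ((1 / p.re) ^ (s + 1) * Real.Gamma (s + 1)) := by
  have hg : IntegrableOn (fun z : ℝ => M * (z ^ s * Real.exp (-p.re * z))) (Ioi 0) := by
    have := integrableOn_rpow_mul_exp_neg_mul_rpow hs one_pos hp
    simp only [Real.rpow_one] at this
    exact this.const_mul M
  have hle : ∀ z ∈ Ioi (0:ℝ), ‖cexp (-(p * z)) * h z‖ ≤ M * (z ^ s * Real.exp (-p.re * z)) := by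
    intro z hz
    rw [norm_mul, Complex.norm_exp]
    have : (-(p * z)).re = -p.re * z := by simp
    rw [this]
    have := hb z hz
    calc _ ≤ Real.exp (-p.re * z) * (M * z ^ s) := by gcongr
      _ = _ := by ring
  have hm : AEStronglyMeasurable (fun z : ℝ => cexp (-(p * z)) * h z) (volume.restrict (Ioi 0)) := by
    refine ContinuousOn.aestronglyMeasurable ?_ measurableSet_Ioi
    refine ContinuousOn.mul ?_ hc
    fun_prop
  have hle' : ∀ᵐ z : ℝ ∂(volume.restrict (Ioi (0:ℝ))), ‖cexp (-(p * z)) * h z‖ ≤ M * (z ^ s * Real.exp (-p.re * z)) :=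
    (ae_restrict_iff' measurableSet_Ioi).2 (ae_of_all _ hle)
  refine ⟨Integrable.mono' hg hm hle', ?_⟩
  refine (norm_integral_le_of_norm_le hg hle').trans (le_of_eq ?_)
  rw [integral_const_mul]
  congr 1
  have := Real.integral_rpow_mul_exp_neg_mul_Ioi (a := s + 1) (r := p.re) (by linarith) hp
  rw [← this]
  simp

open Complex in
lemma lap_tendsto (h : ℝ → ℂ) (s M : ℝ)
    (hb : ∀ z, 0 < z → ‖h z‖ ≤ M * z ^ s) (p : ℂ) (hp : 0 < p.re) :
    Tendsto (fun z : ℝ => cexp (-(p * z)) * h z) atTop (nhds 0) := by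
  have h1 := (tendsto_rpow_mul_exp_neg_mul_atTop_nhds_zero s p.re hp).const_mul M
  rw [mul_zero] at h1
  refine squeeze_zero_norm' ?_ h1
  filter_upwards [eventually_gt_atTop 0] with z hz
  rw [norm_mul, Complex.norm_exp]
  have : (-(p * z)).re = -p.re * z := by simp
  rw [this]
  have := hb z hz
  calc _ ≤ Real.exp (-p.re * z) * (M * z ^ s) := by gcongr
    _ = _ := by ring

open Complex in
lemma lap_deriv (h : ℝ → ℂ) (hc : ContinuousOn h (Ioi 0)) (s M : ℝ) (hs : -1 < s)
    (hb : ∀ z, 0 < z → ‖h z‖ ≤ M * z ^ s) (p : ℂ) (hp : 0 < p.re) :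
    HasDerivAt (fun p : ℂ => ∫ z : ℝ in Ioi 0, cexp (-(p * z)) * h z)
      (∫ z : ℝ in Ioi 0, cexp (-(p * z)) * (-z * h z)) p := by
  have hc' : ContinuousOn (fun z : ℝ => (-z : ℂ) * h z) (Ioi 0) :=
    ContinuousOn.mul (by fun_prop) hc
  have hb' : ∀ z : ℝ, 0 < z → ‖(-z : ℂ) * h z‖ ≤ M * z ^ (s + 1) := by
    intro z hz
    rw [norm_mul, norm_neg, norm_real, Real.norm_eq_abs, abs_of_pos hz, Real.rpow_add_one hz.ne']
    have := hb z hz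
    calc _ ≤ z * (M * z ^ s) := by gcongr
      _ = _ := by ring
  have hp2 : 0 < ((p.re / 2 : ℝ) : ℂ).re := by rw [ofReal_re]; positivity
  refine (hasDerivAt_integral_of_dominated_loc_of_deriv_le (μ := volume.restrict (Ioi (0:ℝ)))
    (F := fun (p : ℂ) (z : ℝ) => cexp (-(p * z)) * h z)
    (F' := fun (p : ℂ) (z : ℝ) => cexp (-(p * z)) * (-z * h z))
    (bound := fun z : ℝ => ‖cexp (-(((p.re / 2 : ℝ) : ℂ) * z)) * (-z * h z)‖)
    (s := Metric.ball p (p.re / 2)) (x₀ := p)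
    (Metric.ball_mem_nhds _ (by positivity)) ?_ (lap_int h hc s M hs hb p hp).1 ?_ ?_ ?_ ?_).2
  · refine Eventually.of_forall fun q => ?_
    refine ContinuousOn.aestronglyMeasurable ?_ measurableSet_Ioi
    exact ContinuousOn.mul (by fun_prop) hc
  · exact (lap_int _ hc' (s + 1) M (by linarith) hb' p hp).1.aestronglyMeasurable
  · refine (ae_restrict_iff' measurableSet_Ioi).2 (ae_of_all _ fun z hz q hq => ?_)
    rw [norm_mul, norm_mul (cexp _)]
    refine mul_le_mul_of_nonneg_right ?_ (norm_nonneg _)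
    rw [Complex.norm_exp, Complex.norm_exp, Real.exp_le_exp]
    simp only [neg_re, mul_re, ofReal_re, ofReal_im, mul_zero, sub_zero]
    have h1 : |(q - p).re| < p.re / 2 := by
      rw [mem_ball_iff_norm] at hq
      exact (abs_re_le_norm _).trans_lt hq
    rw [sub_re, abs_lt] at h1
    have : (0:ℝ) < z := hz
    nlinarith [h1.1]
  · exact (lap_int _ hc' (s + 1) M (by linarith) hb' _ hp2).1.norm
  · refine ae_of_all _ fun z q _ => ?_
    have h1 : HasDerivAt (fun q : ℂ => -(q * z)) (-(1 * z)) q := ((hasDerivAt_id q).mul_const _).neg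
    refine (h1.cexp.mul_const (h z)).congr_deriv ?_
    ring

/-- `z^ν J_ν(z)` -/
def wB (ν z : ℝ) : ℝ := z ^ (ν - 1 / 2) * fB ν z
def wB1 (ν z : ℝ) : ℝ := z ^ (ν - 1 / 2) * fB (ν - 1) z

lemma hasDerivAt_wB (ν z : ℝ) (hν : 0 < ν) (hz : 0 < z) : HasDerivAt (wB ν) (wB1 ν z) z := by
  have h1 := hasDerivAt_fB_succ (ν - 1) z (by linarith) hz
  rw [sub_add_cancel] at h1
  have h2 : HasDerivAt (fun z : ℝ => z ^ (ν - 1 / 2)) (1 * (ν - 1 / 2) * z ^ (ν - 1 / 2 - 1)) z :=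
    (hasDerivAt_id z).rpow_const (Or.inl hz.ne')
  refine (h2.mul h1).congr_deriv ?_
  rw [Real.rpow_sub_one hz.ne', wB1]
  field_simp
  ring

lemma hasDerivAt_wB1 (ν z : ℝ) (hν : 0 < ν) (hz : 0 < z) :
    HasDerivAt (wB1 ν) ((2 * ν - 1) / z * wB1 ν z - wB ν z) z := by
  have h1 := hasDerivAt_fB (ν - 1) z (by linarith) hz
  rw [sub_add_cancel] at h1
  have h2 : HasDerivAt (fun z : ℝ => z ^ (ν - 1 / 2)) (1 * (ν - 1 / 2) * z ^ (ν - 1 / 2 - 1)) z :=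
    (hasDerivAt_id z).rpow_const (Or.inl hz.ne')
  refine (h2.mul h1).congr_deriv ?_
  rw [Real.rpow_sub_one hz.ne', wB1, wB]
  field_simp
  ring

lemma wB_bound (ν M : ℝ) (hν : 1 < ν) (h : ∀ z, 0 < z → |fB ν z| ≤ M) (z : ℝ) (hz : 0 ≤ z) :
    ‖(wB ν z : ℂ)‖ ≤ M * z ^ (ν - 1 / 2) := by
  rw [Complex.norm_real, wB, norm_mul, Real.norm_eq_abs, Real.norm_eq_abs, abs_of_nonneg (by positivity)]
  rcases hz.eq_or_lt with rfl | hz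
  · rw [Real.zero_rpow (by linarith)]; simp
  · rw [mul_comm]; gcongr; exact h z hz

lemma wB1_bound (ν M : ℝ) (hν : 1 < ν) (h : ∀ z, 0 < z → |fB (ν - 1) z| ≤ M) (z : ℝ) (hz : 0 ≤ z) :
    ‖(wB1 ν z : ℂ)‖ ≤ M * z ^ (ν - 1 / 2) := by
  rw [Complex.norm_real, wB1, norm_mul, Real.norm_eq_abs, Real.norm_eq_abs, abs_of_nonneg (by positivity)]
  rcases hz.eq_or_lt with rfl | hz
  · rw [Real.zero_rpow (by linarith)]; simp
  · rw [mul_comm]; gcongr; exact h z hz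

def lapB (ν : ℝ) (p : ℂ) : ℂ := ∫ z : ℝ in Ioi 0, Complex.exp (-(p * z)) * (wB ν z : ℂ)

lemma wB_cont (ν : ℝ) (hν : 0 < ν) : ContinuousOn (fun z : ℝ => (wB ν z : ℂ)) (Ioi 0) :=
  fun z hz => (hasDerivAt_wB ν z hν hz).ofReal_comp.continuousAt.continuousWithinAt

lemma zmul_bound (h : ℝ → ℂ) (s M : ℝ) (hb : ∀ z, 0 < z → ‖h z‖ ≤ M * z ^ s) :
    ∀ z : ℝ, 0 < z → ‖(z : ℂ) * h z‖ ≤ M * z ^ (s + 1) := by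
  intro z hz
  rw [norm_mul, Complex.norm_real, Real.norm_eq_abs, abs_of_pos hz, Real.rpow_add_one hz.ne']
  have := hb z hz
  calc _ ≤ z * (M * z ^ s) := by gcongr
    _ = _ := by ring

open Complex in
lemma lapB_ode (ν : ℝ) (hν : 1 < ν) (p : ℂ) (hp : 0 < p.re) :
    ∃ L', HasDerivAt (lapB ν) L' p ∧ (1 + p ^ 2) * L' + (2 * ν + 1) * p * lapB ν p = 0 := by
  obtain ⟨M, hM0, hM⟩ := fB_bdd ν (by linarith)
  obtain ⟨M1, hM10, hM1⟩ := fB_bdd (ν - 1) (by linarith)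
  have hb := wB_bound ν M hν hM
  have hb1 := wB1_bound ν M1 hν hM1
  have hc := wB_cont ν (by linarith)
  have hd := lap_deriv _ hc (ν - 1 / 2) M (by linarith) (fun z hz => hb z hz.le) p hp
  refine ⟨_, hd, ?_⟩
  set Q : ℝ → ℂ := fun z => cexp (-(p * z)) * (-(z * wB1 ν z) - p * (z * wB ν z) + 2 * ν * wB ν z) with hQ
  have hQd : ∀ z ∈ Ioi (0:ℝ), HasDerivAt Q (cexp (-(p * z)) * (z * wB ν z) * (1 + p ^ 2)
      - (2 * ν + 1) * p * (cexp (-(p * z)) * wB ν z)) z := by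
    intro z hz
    have hz0 : (0:ℝ) < z := hz
    have hzc : (z:ℂ) ≠ 0 := by exact_mod_cast hz0.ne'
    have hid : HasDerivAt (fun z : ℝ => (z:ℂ)) 1 z := (hasDerivAt_id z).ofReal_comp
    have d0 := (hasDerivAt_wB ν z (by linarith) hz).ofReal_comp
    have d1 := (hasDerivAt_wB1 ν z (by linarith) hz).ofReal_comp
    have de := ((hid.const_mul p).neg).cexp
    have := de.mul (((hid.mul d1).neg.sub ((hid.mul d0).const_mul p)).add (d0.const_mul (2 * ν : ℂ)))
    refine this.congr_deriv ?_
    simp only [Pi.add_apply, Pi.sub_apply, Pi.neg_apply, Pi.mul_apply]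
    push_cast
    field_simp
    ring
  have hi0 := (lap_int _ hc (ν - 1 / 2) M (by linarith) (fun z hz => hb z hz.le) p hp).1
  have hi1 := (lap_int (fun z : ℝ => (z:ℂ) * wB ν z) (ContinuousOn.mul (by fun_prop) hc) (ν - 1 / 2 + 1) M
    (by linarith) (zmul_bound _ _ _ fun z hz => hb z hz.le) p hp).1
  have hint : IntegrableOn (fun z : ℝ => cexp (-(p * z)) * (z * wB ν z) * (1 + p ^ 2)
      - (2 * ν + 1) * p * (cexp (-(p * z)) * wB ν z)) (Ioi 0) :=
    (hi1.mul_const _).sub (hi0.const_mul _)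
  have hlim : Tendsto Q atTop (nhds 0) := by
    have t0 := lap_tendsto _ (ν - 1 / 2) M (fun z hz => hb z hz.le) p hp
    have t1 := lap_tendsto (fun z : ℝ => (z:ℂ) * wB ν z) _ M (zmul_bound _ _ _ fun z hz => hb z hz.le) p hp
    have t2 := lap_tendsto (fun z : ℝ => (z:ℂ) * wB1 ν z) _ M1 (zmul_bound _ _ _ fun z hz => hb1 z hz.le) p hp
    have := (t2.neg.sub (t1.const_mul p)).add (t0.const_mul (2 * ν : ℂ))
    simp only [neg_zero, mul_zero, sub_zero, add_zero] at this
    refine this.congr fun z => ?_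
    rw [hQ]; ring
  have hz0 : wB ν 0 = 0 := by rw [wB, Real.zero_rpow (by linarith), zero_mul]
  have hpow : Tendsto (fun z : ℝ => z ^ (ν - 1 / 2)) (nhdsWithin 0 (Ici 0)) (nhds 0) := by
    have : ContinuousAt (fun z : ℝ => z ^ (ν - 1 / 2)) 0 :=
      Real.continuousAt_rpow_const 0 _ (Or.inr (by linarith))
    have h2 := this.tendsto
    rw [Real.zero_rpow (by linarith)] at h2
    exact h2.mono_left nhdsWithin_le_nhds
  have hcont : ContinuousWithinAt Q (Ici 0) 0 := by
    have hpM := hpow.const_mul M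
    have hpM1 := hpow.const_mul M1
    rw [mul_zero] at hpM hpM1
    have t0 : Tendsto (fun z : ℝ => (wB ν z : ℂ)) (nhdsWithin 0 (Ici 0)) (nhds 0) := by
      refine squeeze_zero_norm' ?_ hpM
      filter_upwards [self_mem_nhdsWithin] with z hz using hb z hz
    have t1 : Tendsto (fun z : ℝ => (wB1 ν z : ℂ)) (nhdsWithin 0 (Ici 0)) (nhds 0) := by
      refine squeeze_zero_norm' ?_ hpM1
      filter_upwards [self_mem_nhdsWithin] with z hz using hb1 z hz
    have tz : Tendsto (fun z : ℝ => (z : ℂ)) (nhdsWithin 0 (Ici 0)) (nhds 0) := by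
      have : Continuous (fun z : ℝ => (z:ℂ)) := continuous_ofReal
      simpa using (this.tendsto 0).mono_left (nhdsWithin_le_nhds (s := Ici (0:ℝ)))
    have te : Tendsto (fun z : ℝ => cexp (-(p * z))) (nhdsWithin 0 (Ici 0)) (nhds 1) := by
      have : Continuous (fun z : ℝ => cexp (-(p * z))) := by fun_prop
      simpa using (this.tendsto 0).mono_left (nhdsWithin_le_nhds (s := Ici (0:ℝ)))
    have := te.mul ((((tz.mul t1).neg).sub ((tz.mul t0).const_mul p)).add (t0.const_mul (2 * ν : ℂ)))
    have hQ0 : Q 0 = 0 := by rw [hQ]; simp [hz0]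
    unfold ContinuousWithinAt
    rw [hQ0]
    simpa using this
  have hfin := integral_Ioi_of_hasDerivAt_of_tendsto hcont hQd hint hlim
  have hQ0 : Q 0 = 0 := by rw [hQ]; simp [hz0]
  rw [hQ0, sub_zero, integral_sub (hi1.mul_const _) (hi0.const_mul _), integral_mul_const,
    integral_const_mul] at hfin
  have hneg : ∫ z : ℝ in Ioi 0, cexp (-(p * z)) * (-z * wB ν z) = - ∫ z : ℝ in Ioi 0, cexp (-(p * z)) * (z * wB ν z) := by
    rw [← integral_neg]; congr 1; ext z; ring
  rw [hneg, lapB]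
  linear_combination -hfin

open Complex in
lemma lapB_const (ν : ℝ) (hν : 1 < ν) (p q : ℂ) (hp : 0 < p.re) (hq : 0 < q.re) :
    lapB ν p * (1 + p ^ 2) ^ ((ν + 1 / 2 : ℝ) : ℂ) = lapB ν q * (1 + q ^ 2) ^ ((ν + 1 / 2 : ℝ) : ℂ) := by
  have hd : ∀ p : ℂ, 0 < p.re → HasDerivAt (fun p => lapB ν p * (1 + p ^ 2) ^ ((ν + 1 / 2 : ℝ) : ℂ)) 0 p := by
    intro p hp
    obtain ⟨L', hL, he⟩ := lapB_ode ν hν p hp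
    have hs : 1 + p ^ 2 ∈ slitPlane := by
      rw [mem_slitPlane_iff]
      by_contra! hcon
      have h1 : (1 + p ^ 2).re = 1 + (p.re ^ 2 - p.im ^ 2) := by simp [sq]
      have h2 : (1 + p ^ 2).im = 2 * p.re * p.im := by simp [sq]; ring
      rw [h1, h2] at hcon
      have h3 : p.im = 0 := by
        have := hcon.2
        have h4 : p.re ≠ 0 := hp.ne'
        simpa [h4] using this
      rw [h3] at hcon
      nlinarith [hcon.1]
    have d2 : HasDerivAt (fun p : ℂ => 1 + p ^ 2) (2 * p) p := by
      refine ((hasDerivAt_pow 2 p).const_add 1).congr_deriv ?_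
      simp
    have d3 := d2.cpow_const (c := ((ν + 1 / 2 : ℝ) : ℂ)) hs
    refine (hL.mul d3).congr_deriv ?_
    have hne : 1 + p ^ 2 ≠ 0 := slitPlane_ne_zero hs
    rw [cpow_sub _ _ hne, cpow_one]
    generalize (1 + p ^ 2) ^ ((ν + 1 / 2 : ℝ) : ℂ) = X
    push_cast
    field_simp
    linear_combination X * he
  have hopen : Convex ℝ {p : ℂ | 0 < p.re} := convex_halfSpace_re_gt 0
  refine hopen.is_const_of_fderivWithin_eq_zero (𝕜 := ℂ) (f := fun p => lapB ν p * (1 + p ^ 2) ^ ((ν + 1 / 2 : ℝ) : ℂ))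
    (fun p hp => (hd p hp).differentiableAt.differentiableWithinAt) ?_ hp hq
  intro p hp
  have ho : IsOpen {p : ℂ | 0 < p.re} := isOpen_lt continuous_const continuous_re
  rw [fderivWithin_of_isOpen ho hp, (hd p hp).hasFDerivAt.fderiv]
  ext; simp
open Complex in
lemma gint (s r : ℝ) (hs : -1 < s) (hr : 0 < r) :
    ∫ z : ℝ in Ioi 0, cexp (-((r : ℂ) * z)) * ((z ^ s : ℝ) : ℂ) =
      (((1 / r) ^ (s + 1) * Real.Gamma (s + 1) : ℝ) : ℂ) := by
  rw [← Real.integral_rpow_mul_exp_neg_mul_Ioi (a := s + 1) (r := r) (by linarith) hr, ← integral_complex_ofReal]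
  congr 1
  ext z
  push_cast
  rw [add_sub_cancel_right]
  ring

lemma rpow_cont (s : ℝ) : ContinuousOn (fun z : ℝ => ((z ^ s : ℝ) : ℂ)) (Ioi 0) := by
  intro z hz
  have h1 : ContinuousAt (fun z : ℝ => z ^ s) z := Real.continuousAt_rpow_const z _ (Or.inl (ne_of_gt hz))
  exact (Complex.continuous_ofReal.continuousAt.comp h1).continuousWithinAt

lemma rpow_bound (s z : ℝ) (hz : 0 < z) : ‖((z ^ s : ℝ) : ℂ)‖ ≤ 1 * z ^ s := by
  rw [Complex.norm_real, Real.norm_eq_abs, abs_of_nonneg (by positivity), one_mul]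

open Complex in
lemma osc_bound (s : ℝ) (hs : 0 < s) (r : ℂ) (hr : 0 < r.re) :
    ‖r‖ * ‖∫ z : ℝ in Ioi 0, cexp (-(r * z)) * ((z ^ s : ℝ) : ℂ)‖ ≤
      s * ((1 / r.re) ^ s * Real.Gamma s) := by
  have i0 := (lap_int _ (rpow_cont s) s 1 (by linarith) (rpow_bound s) r hr).1
  have i1 := lap_int _ (rpow_cont (s - 1)) (s - 1) 1 (by linarith) (rpow_bound (s - 1)) r hr
  have hlim := lap_tendsto _ s 1 (rpow_bound s) r hr
  have hd : ∀ z ∈ Ioi (0:ℝ), HasDerivAt (fun z : ℝ => cexp (-(r * z)) * ((z ^ s : ℝ) : ℂ))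
      (s * (cexp (-(r * z)) * ((z ^ (s - 1) : ℝ) : ℂ)) - r * (cexp (-(r * z)) * ((z ^ s : ℝ) : ℂ))) z := by
    intro z hz
    have hid : HasDerivAt (fun z : ℝ => (z:ℂ)) 1 z := (hasDerivAt_id z).ofReal_comp
    have de := ((hid.const_mul r).neg).cexp
    have d2 : HasDerivAt (fun z : ℝ => z ^ s) (1 * s * z ^ (s - 1)) z :=
      (hasDerivAt_id z).rpow_const (Or.inl (ne_of_gt hz))
    refine (de.mul d2.ofReal_comp).congr_deriv ?_
    simp only [Pi.neg_apply]
    push_cast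
    ring
  have hcont : ContinuousWithinAt (fun z : ℝ => cexp (-(r * z)) * ((z ^ s : ℝ) : ℂ)) (Ici 0) 0 := by
    refine ContinuousAt.continuousWithinAt ?_
    have h1 : ContinuousAt (fun z : ℝ => z ^ s) 0 := Real.continuousAt_rpow_const 0 _ (Or.inr hs.le)
    refine ContinuousAt.mul (by fun_prop) ?_
    exact ContinuousAt.comp (f := fun z : ℝ => z ^ s) (g := fun x : ℝ => (x : ℂ))
      Complex.continuous_ofReal.continuousAt h1
  have hfin := integral_Ioi_of_hasDerivAt_of_tendsto hcont hd ((i1.1.const_mul _).sub (i0.const_mul _)) hlim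
  rw [integral_sub (i1.1.const_mul _) (i0.const_mul _), integral_const_mul, integral_const_mul,
    Real.zero_rpow hs.ne'] at hfin
  simp only [ofReal_zero, mul_zero, sub_zero] at hfin
  rw [← norm_mul, ← sub_eq_zero.1 hfin, norm_mul, norm_real, Real.norm_eq_abs, abs_of_pos hs]
  gcongr
  simpa using i1.2

open Complex in
lemma lapB_lim_inf (ν : ℝ) (hν : 1 < ν) :
    Tendsto (fun p : ℝ => lapB ν p * (1 + (p : ℂ) ^ 2) ^ ((ν + 1 / 2 : ℝ) : ℂ)) atTop
      (nhds (((1 / 2) ^ ν / Real.Gamma (ν + 1) * Real.Gamma (2 * ν + 1) : ℝ) : ℂ)) := by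
  set c : ℝ := (1 / 2) ^ ν / Real.Gamma (ν + 1) with hc
  have hPsi0 : Psi ν 0 = 1 / Real.Gamma (ν + 1) := by
    unfold Psi
    rw [tsum_eq_single 0]
    · simp [psiCoef]
    · intro k hk; simp [hk]
  have hw : ∀ z, 0 < z → wB ν z = (1 / 2) ^ ν * z ^ (2 * ν) * Psi ν (z ^ 2 / 4) := by
    intro z hz
    rw [wB, fB, show z / 2 = (1/2) * z by ring, Real.mul_rpow (by norm_num) hz.le,
      show 2 * ν = (ν - 1/2) + (1/2) + ν by ring, Real.rpow_add hz, Real.rpow_add hz]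
    ring
  obtain ⟨M, hM0, hM⟩ := fB_bdd ν (by linarith)
  obtain ⟨N, hN⟩ := (isCompact_Icc (a := (0:ℝ)) (b := 1)).exists_bound_of_continuousOn
    (continuous_psi (ν + 1) (by linarith)).continuousOn
  have hN0 : 0 ≤ N := (norm_nonneg _).trans (hN 0 (by simp))
  have hlip : ∀ q ∈ Icc (0:ℝ) 1, |Psi ν q - Psi ν 0| ≤ N * q := by
    intro q hq
    have := (convex_Icc (0:ℝ) 1).norm_image_sub_le_of_norm_hasDerivWithin_le (f := Psi ν)
      (fun x _ => (hasDerivAt_psi ν (by linarith) x).hasDerivWithinAt)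
      (fun x hx => by rw [norm_neg]; exact hN x hx) (x := 0) (y := q) (by simp) hq
    simpa [abs_of_nonneg hq.1] using this
  have hcpos : 0 ≤ |c| := abs_nonneg c
  have hbound : ∀ z : ℝ, 0 < z → ‖((wB ν z : ℂ) - ((c * z ^ (2 * ν) : ℝ) : ℂ))‖ ≤ (N + M + |c|) * z ^ (2 * ν + 1) := by
    intro z hz
    rw [← ofReal_sub, norm_real, Real.norm_eq_abs]
    rcases le_total z 1 with h | h
    · have h1 := hlip (z ^ 2 / 4) ⟨by positivity, by nlinarith⟩
      have h2 : wB ν z - c * z ^ (2 * ν) = (1 / 2) ^ ν * z ^ (2 * ν) * (Psi ν (z ^ 2 / 4) - Psi ν 0) := by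
        rw [hw z hz, hPsi0, hc]; ring
      have h3 : ((1:ℝ) / 2) ^ ν ≤ 1 := Real.rpow_le_one (by norm_num) (by norm_num) (by linarith)
      rw [h2, abs_mul, abs_of_nonneg (by positivity), Real.rpow_add_one hz.ne']
      calc _ ≤ 1 * z ^ (2 * ν) * (N * z) := by
            gcongr
            refine h1.trans ?_
            gcongr
            nlinarith
        _ = N * (z ^ (2 * ν) * z) := by ring
        _ ≤ _ := by gcongr; linarith
    · have h1 := wB_bound ν M hν hM z hz.le
      rw [norm_real, Real.norm_eq_abs] at h1
      have h2 : z ^ (ν - 1 / 2) ≤ z ^ (2 * ν + 1) := Real.rpow_le_rpow_of_exponent_le h (by linarith)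
      have h3 : z ^ (2 * ν) ≤ z ^ (2 * ν + 1) := Real.rpow_le_rpow_of_exponent_le h (by linarith)
      calc _ ≤ |wB ν z| + |c * z ^ (2 * ν)| := abs_sub _ _
        _ ≤ M * z ^ (2 * ν + 1) + |c| * z ^ (2 * ν + 1) := by
            rw [abs_mul, abs_of_nonneg (by positivity : 0 ≤ z ^ (2 * ν))]
            gcongr
            exact h1.trans (by gcongr)
        _ = 0 + (M + |c|) * z ^ (2 * ν + 1) := by ring
        _ ≤ _ := by
            have : 0 ≤ N * z ^ (2 * ν + 1) := by positivity
            linarith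
  set K := (N + M + |c|) * Real.Gamma (2 * ν + 1 + 1) with hK
  have hLb : ∀ p : ℝ, 0 < p → ‖lapB ν p - ((c * ((1 / p) ^ (2 * ν + 1) * Real.Gamma (2 * ν + 1)) : ℝ) : ℂ)‖
      ≤ K * (1 / p) ^ (2 * ν + 1 + 1) := by
    intro p hp
    have hp' : 0 < (p : ℂ).re := by simpa using hp
    have h1 := lap_int _ ((wB_cont ν (by linarith)).sub ((rpow_cont (2 * ν)).const_smul (c:ℂ))) (2 * ν + 1)
      (N + M + |c|) (by linarith) (fun z hz => by
        have := hbound z hz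
        simpa using this) (p : ℂ) hp'
    have i1 := (lap_int _ (rpow_cont (2 * ν)) (2 * ν) 1 (by linarith) (rpow_bound (2 * ν)) (p:ℂ) hp').1
    have i0 := (lap_int _ (wB_cont ν (by linarith)) (ν - 1 / 2) M (by linarith)
      (fun z hz => wB_bound ν M hν hM z hz.le) (p:ℂ) hp').1
    have h2 : ∫ z : ℝ in Ioi 0, cexp (-((p:ℂ) * z)) * ((wB ν z : ℂ) - (c:ℂ) • ((z ^ (2 * ν) : ℝ) : ℂ))
        = lapB ν p - ((c * ((1 / p) ^ (2 * ν + 1) * Real.Gamma (2 * ν + 1)) : ℝ) : ℂ) := by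
      rw [ofReal_mul c, ← gint (2 * ν) p (by linarith) hp, lapB, ← integral_const_mul, ← integral_sub i0 (i1.const_mul _)]
      congr 1
      ext z
      rw [smul_eq_mul]
      ring
    rw [← h2]
    refine h1.2.trans (le_of_eq ?_)
    rw [hK, ofReal_re]; ring
  -- `p^(2ν+1) L(p)` tends to the limit
  have hT1 : Tendsto (fun p : ℝ => lapB ν p * ((p ^ (2 * ν + 1) : ℝ) : ℂ)) atTop
      (nhds ((c * Real.Gamma (2 * ν + 1) : ℝ) : ℂ)) := by
    rw [tendsto_iff_norm_sub_tendsto_zero]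
    have hz : Tendsto (fun p : ℝ => K * p⁻¹) atTop (nhds 0) := by
      simpa using tendsto_inv_atTop_zero.const_mul K
    refine squeeze_zero' (Eventually.of_forall fun _ => norm_nonneg _) ?_ hz
    filter_upwards [eventually_gt_atTop 0] with p hp
    have hpp : 0 < p ^ (2 * ν + 1) := Real.rpow_pos_of_pos hp _
    have e1 : (1 / p) ^ (2 * ν + 1) = (p ^ (2 * ν + 1))⁻¹ := by rw [one_div, Real.inv_rpow hp.le]
    have h1 : lapB ν p * ((p ^ (2 * ν + 1) : ℝ) : ℂ) - ((c * Real.Gamma (2 * ν + 1) : ℝ) : ℂ)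
        = (lapB ν p - ((c * ((1 / p) ^ (2 * ν + 1) * Real.Gamma (2 * ν + 1)) : ℝ) : ℂ)) * ((p ^ (2 * ν + 1) : ℝ) : ℂ) := by
      have : c * Real.Gamma (2 * ν + 1) = c * ((1 / p) ^ (2 * ν + 1) * Real.Gamma (2 * ν + 1)) * p ^ (2 * ν + 1) := by
        rw [e1]; field_simp
      rw [this, sub_mul, ofReal_mul (_ * _) (p ^ _)]
    rw [h1, norm_mul, norm_real, Real.norm_eq_abs, abs_of_pos hpp]
    calc _ ≤ K * (1 / p) ^ (2 * ν + 1 + 1) * p ^ (2 * ν + 1) := by gcongr; exact hLb p hp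
      _ = K * p⁻¹ := by
        rw [Real.rpow_add_one (by positivity), e1]; field_simp
  have hT2 : Tendsto (fun p : ℝ => (((p⁻¹ ^ 2 + 1) ^ (ν + 1 / 2) : ℝ) : ℂ)) atTop (nhds ((1:ℝ):ℂ)) := by
    refine (Complex.continuous_ofReal.tendsto 1).comp ?_
    have h1 : Tendsto (fun p : ℝ => p⁻¹ ^ 2 + 1) atTop (nhds 1) := by
      simpa using (tendsto_inv_atTop_zero.pow 2).add_const (1:ℝ)
    have h2 := h1.rpow_const (p := ν + 1 / 2) (Or.inl one_ne_zero)
    rwa [Real.one_rpow] at h2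
  have hT := hT1.mul hT2
  rw [ofReal_one, mul_one] at hT
  refine hT.congr' ?_
  filter_upwards [eventually_gt_atTop 0] with p hp
  rw [mul_assoc]
  congr 1
  rw [show (1 + (p:ℂ) ^ 2) = ((1 + p ^ 2 : ℝ) : ℂ) by push_cast; rfl, ← ofReal_cpow (by positivity), ← ofReal_mul]
  congr 1
  have : 1 + p ^ 2 = p ^ 2 * (p⁻¹ ^ 2 + 1) := by field_simp
  rw [this, Real.mul_rpow (by positivity) (by positivity), ← Real.rpow_natCast p 2, ← Real.rpow_mul hp.le]
  congr 2
  push_cast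
  ring

open Complex in
lemma lapB_lim_eps (ν a b C : ℝ) (hν : 1 < ν) (hC : 0 ≤ C)
    (has : ∀ z, 1 ≤ z → |fB ν z - (a * Real.cos z + b * Real.sin z)| ≤ C / z) :
    Tendsto (fun ε : ℝ => lapB ν (ε + I) * (1 + ((ε : ℂ) + I) ^ 2) ^ ((ν + 1 / 2 : ℝ) : ℂ)) (nhdsWithin 0 (Ioi 0))
      (nhds ((a - b * I) / 2 * Real.Gamma (ν + 1 / 2) * (2 * I) ^ ((ν + 1 / 2 : ℝ) : ℂ))) := by
  obtain ⟨M, hM0, hM⟩ := fB_bdd ν (by linarith)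
  set s := ν - 1 / 2 with hs
  have hs0 : 0 < s := by rw [hs]; linarith
  have hν2 : ν + 1 / 2 = s + 1 := by rw [hs]; ring
  rw [hν2]
  set D := C + M + |a| + |b| with hD
  have he : ∀ z, 0 < z → |fB ν z - (a * Real.cos z + b * Real.sin z)| ≤ D / z := by
    intro z hz
    rcases le_total z 1 with h | h
    · have h1 : |fB ν z - (a * Real.cos z + b * Real.sin z)| ≤ M + (|a| + |b|) := by
        refine (abs_sub _ _).trans (add_le_add (hM z hz) ((abs_add_le _ _).trans ?_))
        rw [abs_mul, abs_mul]
        refine add_le_add ?_ ?_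
        · exact mul_le_of_le_one_right (abs_nonneg _) (Real.abs_cos_le_one _)
        · exact mul_le_of_le_one_right (abs_nonneg _) (Real.abs_sin_le_one _)
      have h2 : D ≤ D / z := le_div_self (by positivity) hz h
      linarith
    · refine (has z h).trans ?_
      gcongr
      have := abs_nonneg a
      have := abs_nonneg b
      linarith
  set h : ℝ → ℂ := fun z => ((z ^ s * (fB ν z - (a * Real.cos z + b * Real.sin z)) : ℝ) : ℂ) with hh
  have hhc : ContinuousOn h (Ioi 0) := by
    intro z hz
    have h1 : ContinuousAt (fun z : ℝ => z ^ s) z := Real.continuousAt_rpow_const z _ (Or.inl (ne_of_gt hz))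
    have h2 : ContinuousAt (fB ν) z := (hasDerivAt_fB ν z (by linarith) hz).continuousAt
    have h3 : ContinuousAt (fun z => z ^ s * (fB ν z - (a * Real.cos z + b * Real.sin z))) z := by fun_prop
    exact (Complex.continuous_ofReal.continuousAt.comp h3).continuousWithinAt
  have hhb : ∀ z, 0 < z → ‖h z‖ ≤ D * z ^ (s - 1) := by
    intro z hz
    rw [hh, norm_real, norm_mul, Real.norm_eq_abs, Real.norm_eq_abs, abs_of_nonneg (by positivity), Real.rpow_sub_one hz.ne']
    calc _ ≤ z ^ s * (D / z) := by gcongr; exact he z hz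
      _ = _ := by ring
  have hwd : ∀ ε z : ℝ, cexp (-(((ε:ℂ) + I) * z)) * (wB ν z : ℂ) =
      (a - b * I) / 2 * (cexp (-((ε : ℂ) * z)) * ((z ^ s : ℝ) : ℂ))
      + (a + b * I) / 2 * (cexp (-(((ε : ℂ) + 2 * I) * z)) * ((z ^ s : ℝ) : ℂ))
      + cexp (-(((ε:ℂ) + I) * z)) * h z := by
    intro ε z
    have e1 : cexp (-((ε : ℂ) * z)) = cexp (-(((ε:ℂ) + I) * z)) * cexp (z * I) := by
      rw [← Complex.exp_add]; ring_nf
    have e2 : cexp (-(((ε : ℂ) + 2 * I) * z)) = cexp (-(((ε:ℂ) + I) * z)) * cexp (-z * I) := by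
      rw [← Complex.exp_add]; ring_nf
    rw [e1, e2, hh, wB, Complex.exp_mul_I, Complex.exp_mul_I, Complex.cos_neg, Complex.sin_neg]
    push_cast
    linear_combination (b * cexp (-(((ε:ℂ) + I) * z)) * ((z ^ s : ℝ) : ℂ) * Complex.sin z) * I_sq
  have hL : ∀ ε : ℝ, 0 < ε → ‖((ε ^ (s + 1) : ℝ) : ℂ) * lapB ν (ε + I) - (a - b * I) / 2 * Real.Gamma (s + 1)‖
      ≤ (‖((a:ℂ) + b * I) / 2‖ * (s * Real.Gamma s) + D * Real.Gamma s) * ε := by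
    intro ε hε
    have hr1 : 0 < (ε : ℂ).re := by simpa using hε
    have hr2 : 0 < ((ε : ℂ) + 2 * I).re := by simpa using hε
    have hr3 : 0 < ((ε : ℂ) + I).re := by simpa using hε
    have i1 := (lap_int _ (rpow_cont s) s 1 (by linarith) (rpow_bound s) _ hr1).1
    have i2 := (lap_int _ (rpow_cont s) s 1 (by linarith) (rpow_bound s) _ hr2).1
    have i3 := lap_int h hhc (s - 1) D (by linarith) hhb _ hr3
    have o2 := osc_bound s hs0 _ hr2
    have hLe : lapB ν (ε + I) = (a - b * I) / 2 * (((1 / ε) ^ (s + 1) * Real.Gamma (s + 1) : ℝ) : ℂ)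
        + (a + b * I) / 2 * (∫ z : ℝ in Ioi 0, cexp (-(((ε : ℂ) + 2 * I) * z)) * ((z ^ s : ℝ) : ℂ))
        + ∫ z : ℝ in Ioi 0, cexp (-(((ε:ℂ) + I) * z)) * h z := by
      rw [lapB]
      simp_rw [hwd ε]
      have i12 : Integrable (fun z : ℝ => ((a:ℂ) - b * I) / 2 * (cexp (-((ε : ℂ) * z)) * ((z ^ s : ℝ) : ℂ))
          + ((a:ℂ) + b * I) / 2 * (cexp (-(((ε : ℂ) + 2 * I) * z)) * ((z ^ s : ℝ) : ℂ))) (volume.restrict (Ioi 0)) :=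
        (i1.const_mul _).add (i2.const_mul _)
      rw [integral_add i12 i3.1, integral_add (i1.const_mul _) (i2.const_mul _),
        integral_const_mul, integral_const_mul, gint s ε (by linarith) hε]
    have hεp : 0 < ε ^ (s + 1) := Real.rpow_pos_of_pos hε _
    have e1 : ε ^ (s + 1) * (1 / ε) ^ (s + 1) = 1 := by
      rw [one_div, Real.inv_rpow hε.le]; field_simp
    have e2 : ε ^ (s + 1) * (1 / ε) ^ s = ε := by
      have := Real.rpow_pos_of_pos hε s
      rw [one_div, Real.inv_rpow hε.le, Real.rpow_add_one hε.ne']; field_simp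
    have hsplit : ((ε ^ (s + 1) : ℝ) : ℂ) * lapB ν (ε + I) - (a - b * I) / 2 * Real.Gamma (s + 1)
        = ((ε ^ (s + 1) : ℝ) : ℂ) * ((a + b * I) / 2 * (∫ z : ℝ in Ioi 0, cexp (-(((ε : ℂ) + 2 * I) * z)) * ((z ^ s : ℝ) : ℂ)))
        + ((ε ^ (s + 1) : ℝ) : ℂ) * ∫ z : ℝ in Ioi 0, cexp (-(((ε:ℂ) + I) * z)) * h z := by
      rw [hLe]
      have e1c : ((ε ^ (s + 1) : ℝ) : ℂ) * (((1 / ε) ^ (s + 1) : ℝ) : ℂ) = 1 := by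
        rw [← ofReal_mul, e1, ofReal_one]
      rw [ofReal_mul ((1 / ε) ^ (s + 1))]
      linear_combination ((a - b * I) / 2 * Real.Gamma (s + 1)) * e1c
    rw [hsplit]
    refine (norm_add_le _ _).trans ?_
    rw [norm_mul, norm_mul, norm_mul, norm_real, Real.norm_eq_abs, abs_of_pos hεp]
    set O := ‖∫ z : ℝ in Ioi 0, cexp (-(((ε : ℂ) + 2 * I) * z)) * ((z ^ s : ℝ) : ℂ)‖
    have hre2 : ((ε : ℂ) + 2 * I).re = ε := by simp
    have hre3 : ((ε : ℂ) + I).re = ε := by simp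
    rw [hre2] at o2
    have hn2 : 1 ≤ ‖(ε : ℂ) + 2 * I‖ := by
      have := abs_im_le_norm ((ε : ℂ) + 2 * I)
      simp at this
      linarith
    have hO : O ≤ s * ((1 / ε) ^ s * Real.Gamma s) :=
      (le_mul_of_one_le_left (norm_nonneg _) hn2).trans o2
    have h3 := i3.2
    rw [hre3, sub_add_cancel] at h3
    calc _ ≤ ε ^ (s + 1) * (‖((a:ℂ) + b * I) / 2‖ * (s * ((1 / ε) ^ s * Real.Gamma s)))
          + ε ^ (s + 1) * (D * ((1 / ε) ^ s * Real.Gamma s)) := by gcongr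
      _ = (‖((a:ℂ) + b * I) / 2‖ * (s * Real.Gamma s) + D * Real.Gamma s) * (ε ^ (s + 1) * (1 / ε) ^ s) := by ring
      _ = _ := by rw [e2]
  have hT1 : Tendsto (fun ε : ℝ => ((ε ^ (s + 1) : ℝ) : ℂ) * lapB ν (ε + I)) (nhdsWithin 0 (Ioi 0))
      (nhds ((a - b * I) / 2 * Real.Gamma (s + 1))) := by
    rw [tendsto_iff_norm_sub_tendsto_zero]
    have hid : Tendsto (fun ε : ℝ => ε) (nhdsWithin 0 (Ioi 0)) (nhds 0) := tendsto_id.mono_left nhdsWithin_le_nhds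
    have hz := hid.const_mul (‖((a:ℂ) + b * I) / 2‖ * (s * Real.Gamma s) + D * Real.Gamma s)
    rw [mul_zero] at hz
    refine squeeze_zero' (Eventually.of_forall fun _ => norm_nonneg _) ?_ hz
    filter_upwards [self_mem_nhdsWithin] with ε hε using hL ε hε
  have hT2 : Tendsto (fun ε : ℝ => ((ε : ℂ) + 2 * I) ^ ((s + 1 : ℝ) : ℂ)) (nhdsWithin 0 (Ioi 0))
      (nhds ((2 * I) ^ ((s + 1 : ℝ) : ℂ))) := by
    have h1 : ContinuousAt (fun ε : ℝ => ((ε : ℂ) + 2 * I) ^ ((s + 1 : ℝ) : ℂ)) 0 := by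
      refine ContinuousAt.cpow (by fun_prop) (by fun_prop) ?_
      rw [mem_slitPlane_iff]; right; simp
    have h2 := h1.tendsto
    simp only [ofReal_zero, zero_add] at h2
    exact h2.mono_left nhdsWithin_le_nhds
  refine (hT1.mul hT2).congr' ?_
  filter_upwards [self_mem_nhdsWithin] with ε hε
  have hε0 : (0:ℝ) < ε := hε
  have e1 : 1 + ((ε:ℂ) + I) ^ 2 = (ε:ℂ) * ((ε:ℂ) + 2 * I) := by
    linear_combination I_sq
  have hne : (ε:ℂ) + 2 * I ≠ 0 := by
    intro h0
    have := congrArg Complex.im h0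
    simp at this
  have hεne : (ε:ℂ) ≠ 0 := by exact_mod_cast hε0.ne'
  have e2 : (1 + ((ε:ℂ) + I) ^ 2) ^ ((s + 1 : ℝ) : ℂ) = ((ε ^ (s + 1) : ℝ) : ℂ) * ((ε : ℂ) + 2 * I) ^ ((s + 1 : ℝ) : ℂ) := by
    rw [e1, ofReal_cpow hε0.le, cpow_def_of_ne_zero (mul_ne_zero hεne hne), cpow_def_of_ne_zero hεne,
      cpow_def_of_ne_zero hne, log_ofReal_mul hε0 hne, ← Complex.exp_add, ofReal_log hε0.le]
    ring_nf
  rw [e2]; ring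

open Complex in
lemma identify (ν a b C : ℝ) (hν : 1 < ν) (hC : 0 ≤ C)
    (has : ∀ z, 1 ≤ z → |fB ν z - (a * Real.cos z + b * Real.sin z)| ≤ C / z) :
    a = Real.sqrt (2 / Real.pi) * Real.cos (Real.pi * ν / 2 + Real.pi / 4) ∧
    b = Real.sqrt (2 / Real.pi) * Real.sin (Real.pi * ν / 2 + Real.pi / 4) := by
  have h1 := lapB_lim_eps ν a b C hν hC has
  have h2 := lapB_lim_inf ν hν
  have hI : 0 < (1 : ℂ).re := by simp
  have c1 : (lapB ν 1 * (1 + (1:ℂ) ^ 2) ^ ((ν + 1 / 2 : ℝ) : ℂ)) =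
      (a - b * I) / 2 * Real.Gamma (ν + 1 / 2) * (2 * I) ^ ((ν + 1 / 2 : ℝ) : ℂ) := by
    refine tendsto_nhds_unique (tendsto_const_nhds.congr' ?_) h1
    filter_upwards [self_mem_nhdsWithin] with ε hε
    exact lapB_const ν hν 1 _ hI (by simpa using hε)
  have c2 : (lapB ν 1 * (1 + (1:ℂ) ^ 2) ^ ((ν + 1 / 2 : ℝ) : ℂ)) =
      (((1 / 2) ^ ν / Real.Gamma (ν + 1) * Real.Gamma (2 * ν + 1) : ℝ) : ℂ) := by
    refine tendsto_nhds_unique (tendsto_const_nhds.congr' ?_) h2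
    filter_upwards [eventually_gt_atTop 0] with p hp
    exact lapB_const ν hν 1 _ hI (by simpa using hp)
  have c3 := c1.symm.trans c2
  set α := Real.pi * ν / 2 + Real.pi / 4 with hα
  have hpow : (2 * I) ^ ((ν + 1 / 2 : ℝ) : ℂ) = ((2 ^ (ν + 1 / 2) : ℝ) : ℂ) * cexp (α * I) := by
    rw [show (2 * I : ℂ) = ((2:ℝ):ℂ) * I by push_cast; rfl, ofReal_cpow (by norm_num),
      cpow_def_of_ne_zero (by simp), cpow_def_of_ne_zero (by simp), log_ofReal_mul (by norm_num) I_ne_zero, log_I,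
      ← Complex.exp_add, ofReal_log (by norm_num), hα]
    push_cast
    ring_nf
  have hG1 : 0 < Real.Gamma (ν + 1 / 2) := Real.Gamma_pos_of_pos (by linarith)
  have hG2 : 0 < Real.Gamma (ν + 1) := Real.Gamma_pos_of_pos (by linarith)
  have hdup := Real.Gamma_mul_Gamma_add_half (ν + 1 / 2)
  rw [show ν + 1 / 2 + 1 / 2 = ν + 1 by ring, show 2 * (ν + 1 / 2) = 2 * ν + 1 by ring,
    show 1 - (2 * ν + 1) = -(2 * ν) by ring] at hdup
  have hpi : 0 < Real.sqrt Real.pi := Real.sqrt_pos.2 Real.pi_pos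
  have h2ν : (0:ℝ) < 2 ^ ν := by positivity
  have hreal : (1 / 2) ^ ν / Real.Gamma (ν + 1) * Real.Gamma (2 * ν + 1)
      = Real.sqrt (2 / Real.pi) / 2 * Real.Gamma (ν + 1 / 2) * 2 ^ (ν + 1 / 2) := by
    have e1 : (2:ℝ) ^ (-(2 * ν)) = (2 ^ ν)⁻¹ * (2 ^ ν)⁻¹ := by
      rw [Real.rpow_neg (by norm_num), two_mul, Real.rpow_add (by norm_num), mul_inv]
    have e2 : ((1:ℝ) / 2) ^ ν = (2 ^ ν)⁻¹ := by rw [one_div, Real.inv_rpow (by norm_num)]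
    have e3 : (2:ℝ) ^ (ν + 1 / 2) = 2 ^ ν * Real.sqrt 2 := by
      rw [Real.rpow_add (by norm_num), Real.sqrt_eq_rpow]
    have e4 : Real.sqrt 2 * Real.sqrt 2 = 2 := Real.mul_self_sqrt (by norm_num)
    rw [e1] at hdup
    rw [e2, e3, Real.sqrt_div (by norm_num)]
    have e5 : Real.Gamma (2 * ν + 1) = Real.Gamma (ν + 1 / 2) * Real.Gamma (ν + 1) * 2 ^ ν * 2 ^ ν / Real.sqrt Real.pi := by
      rw [hdup]; field_simp
    rw [e5]
    field_simp
    rw [sq, e4]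
  rw [hpow, hreal] at c3
  have hex : cexp (α * I) * cexp (-α * I) = 1 := by rw [← Complex.exp_add]; simp
  have hGc : (Real.Gamma (ν + 1 / 2) : ℂ) ≠ 0 := by exact_mod_cast hG1.ne'
  have h2c : ((2 ^ (ν + 1 / 2) : ℝ) : ℂ) ≠ 0 := by
    have : (0:ℝ) < 2 ^ (ν + 1 / 2) := by positivity
    exact_mod_cast this.ne'
  have c4 : (a - b * I : ℂ) * cexp (α * I) = Real.sqrt (2 / Real.pi) := by
    rw [ofReal_mul, ofReal_mul, ofReal_div] at c3
    have : (Real.Gamma (ν + 1 / 2) : ℂ) * ((2 ^ (ν + 1 / 2) : ℝ) : ℂ) ≠ 0 := mul_ne_zero hGc h2c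
    refine mul_right_cancel₀ this ?_
    push_cast at c3 ⊢
    linear_combination 2 * c3
  have c5 : (a - b * I : ℂ) = Real.sqrt (2 / Real.pi) * cexp (-α * I) := by
    linear_combination cexp (-α * I) * c4 - (a - b * I) * hex
  rw [Complex.exp_mul_I, Complex.cos_neg, Complex.sin_neg, ← ofReal_cos, ← ofReal_sin] at c5
  constructor
  · have := congrArg Complex.re c5
    simp only [sub_re, mul_re, add_re, neg_re, neg_im, ofReal_re, ofReal_im, I_re, I_im, add_im, mul_im] at this
    linarith
  · have := congrArg Complex.im c5
    simp only [sub_im, mul_re, add_re, neg_re, neg_im, ofReal_re, ofReal_im, I_re, I_im, add_im, mul_im] at this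
    linarith
lemma uniq0 (a b C : ℝ) (h : ∀ z : ℝ, 1 ≤ z → |a * Real.cos z + b * Real.sin z| ≤ C / z) : a = 0 ∧ b = 0 := by
  have hpi := Real.pi_gt_three
  have key : ∀ c d : ℝ, (∀ n : ℕ, |c| ≤ C / (((n:ℝ) + 1) * (2 * Real.pi) + d)) → c = 0 := by
    intro c d hc
    have h1 : Tendsto (fun n : ℕ => ((n:ℝ) + 1) * (2 * Real.pi) + d) atTop atTop := by
      refine tendsto_atTop_add_const_right _ _ ?_
      refine Tendsto.atTop_mul_const (by positivity) ?_
      exact tendsto_atTop_add_const_right _ _ tendsto_natCast_atTop_atTop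
    have h2 := h1.const_div_atTop C
    have h3 := ge_of_tendsto' h2 hc
    exact abs_nonpos_iff.1 h3
  have hn : ∀ n : ℕ, 1 ≤ ((n:ℝ) + 1) * (2 * Real.pi) := by
    intro n
    have : (0:ℝ) ≤ n := n.cast_nonneg
    nlinarith
  constructor
  · refine key a 0 fun n => ?_
    have e : ((n:ℝ) + 1) * (2 * Real.pi) = ((n + 1 : ℕ) : ℝ) * (2 * Real.pi) := by push_cast; ring
    have e2 : Real.sin (((n + 1 : ℕ) : ℝ) * (2 * Real.pi)) = 0 := by
      have := Real.sin_add_nat_mul_two_pi 0 (n + 1)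
      rwa [zero_add, Real.sin_zero] at this
    have := h _ (hn n)
    rw [add_zero]
    rwa [e, Real.cos_nat_mul_two_pi, e2, mul_one, mul_zero, add_zero, ← e] at this
  · refine key b (Real.pi / 2) fun n => ?_
    have := h (((n:ℝ) + 1) * (2 * Real.pi) + Real.pi / 2) (by linarith [hn n])
    have e : ((n:ℝ) + 1) * (2 * Real.pi) + Real.pi / 2 = Real.pi / 2 + ((n + 1 : ℕ) : ℝ) * (2 * Real.pi) := by push_cast; ring
    rw [e] at this ⊢
    rwa [Real.cos_add_nat_mul_two_pi, Real.sin_add_nat_mul_two_pi, Real.cos_pi_div_two, Real.sin_pi_div_two,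
      mul_one, mul_zero, zero_add] at this

def kap : ℝ := Real.sqrt (2 / Real.pi)

def alp (ν : ℝ) : ℝ := Real.pi * ν / 2 + Real.pi / 4

/-- first order asymptotics of `fB ν` with a constant. -/
def asy (ν : ℝ) : Prop :=
  ∃ C, ∀ z : ℝ, 1 ≤ z → |fB ν z - kap * Real.cos (z - alp ν)| ≤ C / z

/-- The constants in `ode_asymp` are the expected ones. -/
lemma asy_full (ν : ℝ) (hν : -1 < ν) (h : asy ν) :
    ∃ C, 0 ≤ C ∧ ∀ z : ℝ, 1 ≤ z → |fB ν z - kap * Real.cos (z - alp ν)| ≤ C / z ∧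
      |fB1 ν z + kap * Real.sin (z - alp ν) + (ν ^ 2 - 1 / 4) / 2 * (kap * Real.cos (z - alp ν)) / z| ≤ C / z ^ 2 := by
  obtain ⟨a, b, C, hC, hz⟩ := ode_asymp (fB ν) (fB1 ν) (ν ^ 2 - 1 / 4)
    (fun z hz => hasDerivAt_fB ν z hν hz) (fun z hz => hasDerivAt_fB1 ν z hν hz)
  obtain ⟨C', h'⟩ := h
  have hu := uniq0 (a - kap * Real.cos (alp ν)) (b - kap * Real.sin (alp ν)) (C + C') (fun z h1 => by
    have e1 := (hz z h1).1
    have e2 := h' z h1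
    rw [Real.cos_sub] at e2
    rw [add_div]
    rw [abs_le] at *
    constructor <;> linarith [e1.1, e1.2, e2.1, e2.2])
  have ha : a = kap * Real.cos (alp ν) := by linarith [hu.1]
  have hb : b = kap * Real.sin (alp ν) := by linarith [hu.2]
  refine ⟨C, hC, fun z h1 => ?_⟩
  obtain ⟨e1, e2⟩ := hz z h1
  subst ha hb
  constructor
  · refine le_trans (le_of_eq ?_) e1
    rw [Real.cos_sub]; ring_nf
  · refine le_trans (le_of_eq ?_) e2
    rw [Real.cos_sub, Real.sin_sub]; ring_nf

lemma kap_pos : 0 ≤ kap := Real.sqrt_nonneg _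

lemma fB_eq_fB1 (ν z : ℝ) (hν : -1 < ν) (hz : 0 < z) : fB ν z = fB1 (ν + 1) z + (ν + 1 / 2) / z * fB (ν + 1) z := by
  have h := fB_rec ν z hν hz
  unfold fB1
  rw [show ν + 1 + 1 = ν + 2 by ring, h]
  ring

lemma asy_step (ν : ℝ) (hν : -1 < ν) (h : asy (ν + 1)) : asy ν := by
  obtain ⟨C, hC, hz⟩ := asy_full (ν + 1) (by linarith) h
  set m := ((ν + 1) ^ 2 - 1 / 4) / 2 with hm
  refine ⟨C + |m| * kap + |ν + 1 / 2| * (C + kap), fun z h1 => ?_⟩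
  have hz0 : 0 < z := by linarith
  obtain ⟨e1, e2⟩ := hz z h1
  have ea : alp (ν + 1) = alp ν + Real.pi / 2 := by unfold alp; ring
  have es : Real.sin (z - alp (ν + 1)) = - Real.cos (z - alp ν) := by
    rw [ea, ← sub_sub, Real.sin_sub_pi_div_two]
  set c' := Real.cos (z - alp (ν + 1)) with hc'
  have hc1 : |kap * c'| ≤ kap := by
    rw [abs_mul, abs_of_nonneg kap_pos]
    exact mul_le_of_le_one_right kap_pos (Real.abs_cos_le_one _)
  have hf : |fB (ν + 1) z| ≤ C + kap := by
    have h2 : C / z ≤ C := div_le_self hC h1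
    have h3 : |fB (ν + 1) z| ≤ |fB (ν + 1) z - kap * c'| + |kap * c'| := by
      have := abs_add_le (fB (ν + 1) z - kap * c') (kap * c')
      rwa [sub_add_cancel] at this
    linarith
  rw [es] at e2
  have e3 : C / z ^ 2 ≤ C / z := by
    gcongr
    nlinarith
  have hs : fB ν z - kap * Real.cos (z - alp ν) =
      (fB1 (ν + 1) z + kap * -Real.cos (z - alp ν) + m * (kap * c') / z)
      + (-(m * (kap * c') / z) + (ν + 1 / 2) / z * fB (ν + 1) z) := by
    rw [fB_eq_fB1 ν z hν hz0]; ring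
  rw [hs]
  refine (abs_add_le _ _).trans ?_
  have e4 : |-(m * (kap * c') / z)| ≤ |m| * kap / z := by
    rw [abs_neg, abs_div, abs_mul, abs_of_pos hz0]
    gcongr
  have e5 : |(ν + 1 / 2) / z * fB (ν + 1) z| ≤ |ν + 1 / 2| * (C + kap) / z := by
    rw [abs_mul, abs_div, abs_of_pos hz0, div_mul_eq_mul_div]
    gcongr
  have e6 := abs_add_le (-(m * (kap * c') / z)) ((ν + 1 / 2) / z * fB (ν + 1) z)
  rw [add_div (C + |m| * kap), add_div C]
  linarith

lemma asy_all (ν : ℝ) (hν : -1 < ν) : asy ν := by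
  have hbig : ∀ μ : ℝ, 1 < μ → asy μ := by
    intro μ hμ
    obtain ⟨a, b, C, hC, hz⟩ := ode_asymp (fB μ) (fB1 μ) (μ ^ 2 - 1 / 4)
      (fun z hz => hasDerivAt_fB μ z (by linarith) hz) (fun z hz => hasDerivAt_fB1 μ z (by linarith) hz)
    obtain ⟨ha, hb⟩ := identify μ a b C hμ hC (fun z h1 => (hz z h1).1)
    refine ⟨C, fun z h1 => ?_⟩
    have := (hz z h1).1
    refine le_trans (le_of_eq ?_) this
    rw [ha, hb, Real.cos_sub]
    unfold alp kap
    ring_nf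
  refine asy_step ν hν (asy_step (ν + 1) (by linarith) (hbig _ (by linarith)))

lemma main_bounds (ν : ℝ) (hν : -1 < ν) :
    ∃ C, 0 ≤ C ∧ ∀ z : ℝ, 0 < z → |fB ν z - kap * Real.cos (z - alp ν)| ≤ C / z ∧
      |fB1 ν z + kap * Real.sin (z - alp ν) + (ν ^ 2 - 1 / 4) / 2 * (kap * Real.cos (z - alp ν)) / z
        - (ν ^ 2 - 1 / 4) / 2 * (kap * Real.sin (z - alp ν)) / z ^ 2| ≤ C / z ^ 2 := by
  obtain ⟨C, hC, hz⟩ := asy_full ν hν (asy_all ν hν)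
  obtain ⟨M, hM, hMz⟩ := fB_small ν hν
  obtain ⟨N, hN, hNz⟩ := fB_small (ν + 1) (by linarith)
  set m := (ν ^ 2 - 1 / 4) / 2
  have hk := kap_pos
  refine ⟨C + M + N + |ν + 1 / 2| * M + kap + 2 * (|m| * kap), by positivity, fun z h0 => ?_⟩
  set c := Real.cos (z - alp ν)
  set s := Real.sin (z - alp ν)
  have hc : |kap * c| ≤ kap := by
    rw [abs_mul, abs_of_nonneg kap_pos]
    exact mul_le_of_le_one_right kap_pos (Real.abs_cos_le_one _)
  have hs : |kap * s| ≤ kap := by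
    rw [abs_mul, abs_of_nonneg kap_pos]
    exact mul_le_of_le_one_right kap_pos (Real.abs_sin_le_one _)
  have hms : |m * (kap * s) / z ^ 2| ≤ |m| * kap / z ^ 2 := by
    rw [abs_div, abs_mul, abs_of_pos (by positivity : 0 < z ^ 2)]
    gcongr
  have hmk : 0 ≤ |m| * kap := by positivity
  have hνM : 0 ≤ |ν + 1 / 2| * M := by positivity
  rcases le_total 1 z with h1 | h1
  · obtain ⟨e1, e2⟩ := hz z h1
    constructor
    · refine e1.trans ?_
      gcongr
      linarith
    · refine (abs_sub _ _).trans ((add_le_add e2 hms).trans ?_)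
      rw [← add_div]
      refine div_le_div_of_nonneg_right ?_ (by positivity)
      linarith
  · have hzz : 1 / z ≤ 1 / z ^ 2 := by
      gcongr
      nlinarith
    have h1z : 1 ≤ 1 / z := by rw [le_div_iff₀ h0]; linarith
    have hf : |fB ν z| ≤ M / z := by
      refine (hMz z h0 h1).trans ?_
      have : z ^ (ν + 1 / 2) ≤ z ^ (-1 : ℝ) := Real.rpow_le_rpow_of_exponent_ge h0 h1 (by linarith)
      rw [Real.rpow_neg_one] at this
      rw [div_eq_mul_inv M]
      gcongr
    have hf' : |fB (ν + 1) z| ≤ N / z := by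
      refine (hNz z h0 h1).trans ?_
      have : z ^ (ν + 1 + 1 / 2) ≤ z ^ (-1 : ℝ) := Real.rpow_le_rpow_of_exponent_ge h0 h1 (by linarith)
      rw [Real.rpow_neg_one] at this
      rw [div_eq_mul_inv N]
      gcongr
    have hk1 : kap ≤ kap / z := le_div_self hk h0 h1
    constructor
    · refine (abs_sub _ _).trans ((add_le_add hf (hc.trans hk1)).trans ?_)
      rw [← add_div]
      refine div_le_div_of_nonneg_right ?_ (by positivity)
      linarith
    · have q1 : |fB1 ν z| ≤ |ν + 1 / 2| * M / z ^ 2 + N / z ^ 2 := by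
        unfold fB1
        refine (abs_sub _ _).trans (add_le_add ?_ (hf'.trans ?_))
        · rw [abs_mul, abs_div, abs_of_pos h0]
          calc _ ≤ |ν + 1 / 2| / z * (M / z) := by gcongr
            _ = _ := by field_simp
        · rw [div_eq_mul_one_div N, div_eq_mul_one_div N]
          gcongr
      have q2 : |kap * s| ≤ kap / z ^ 2 := by
        refine hs.trans (hk1.trans ?_)
        rw [div_eq_mul_one_div kap, div_eq_mul_one_div kap (z ^ 2)]
        gcongr
      have q3 : |m * (kap * c) / z| ≤ |m| * kap / z ^ 2 := by
        rw [abs_div, abs_mul, abs_of_pos h0]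
        calc _ ≤ |m| * kap / z := by gcongr
          _ ≤ _ := by
            rw [div_eq_mul_one_div (|m| * kap), div_eq_mul_one_div (|m| * kap) (z ^ 2)]
            gcongr
      have q4 : 0 ≤ (C + M) / z ^ 2 := by positivity
      have t1 := abs_sub (fB1 ν z + kap * s + m * (kap * c) / z) (m * (kap * s) / z ^ 2)
      have t2 := abs_add_le (fB1 ν z + kap * s) (m * (kap * c) / z)
      have t3 := abs_add_le (fB1 ν z) (kap * s)
      have : (C + M + N + |ν + 1 / 2| * M + kap + 2 * (|m| * kap)) / z ^ 2 =
        (C + M) / z ^ 2 + (|ν + 1 / 2| * M / z ^ 2 + N / z ^ 2) + kap / z ^ 2 + |m| * kap / z ^ 2 + |m| * kap / z ^ 2 := by ring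
      linarith
lemma kernel_bound (f f1 : ℝ → ℝ) (κ α m C : ℝ) (hκ : 0 ≤ κ) (hC : 0 ≤ C)
    (hf : ∀ z, 0 < z → HasDerivAt f (f1 z) z) (hf1 : ContinuousOn f1 (Ioi 0))
    (b1 : ∀ z, 0 < z → |f z - κ * Real.cos (z - α)| ≤ C / z)
    (b2 : ∀ z, 0 < z → |f1 z + κ * Real.sin (z - α) + m * (κ * Real.cos (z - α)) / z
        - m * (κ * Real.sin (z - α)) / z ^ 2| ≤ C / z ^ 2) :
    ∃ D, 0 ≤ D ∧ ∀ t x y : ℝ, 0 < t → 0 < x → 0 < y → ∃ L, |L| ≤ D / (x * y * t) ∧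
      Tendsto (fun S : ℝ => ∫ s in t..S, (f (x * s) * f (y * s) -
        κ * Real.cos (x * s - α) * (κ * Real.cos (y * s - α)))) atTop (nhds L) := by
  set g : ℝ → ℝ := fun z => κ * Real.cos (z - α) with hg
  set k : ℝ → ℝ := fun z => κ * Real.sin (z - α) with hk
  set r : ℝ → ℝ := fun z => f z - g z + m * k z / z with hr
  set r1 : ℝ → ℝ := fun z => f1 z + k z + m * g z / z - m * k z / z ^ 2 with hr1
  have dg : ∀ z, HasDerivAt g (- k z) z := by
    intro z
    have := (((hasDerivAt_id z).sub_const α).cos).const_mul κ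
    refine this.congr_deriv ?_
    simp [hk]
  have dk : ∀ z, HasDerivAt k (g z) z := by
    intro z
    have := (((hasDerivAt_id z).sub_const α).sin).const_mul κ
    refine this.congr_deriv ?_
    simp [hg]
  have gb : ∀ z, |g z| ≤ κ := fun z => by
    rw [hg, abs_mul, abs_of_nonneg hκ]
    exact mul_le_of_le_one_right hκ (Real.abs_cos_le_one _)
  have kb : ∀ z, |k z| ≤ κ := fun z => by
    rw [hk, abs_mul, abs_of_nonneg hκ]
    exact mul_le_of_le_one_right hκ (Real.abs_sin_le_one _)
  have dr : ∀ z, 0 < z → HasDerivAt r (r1 z) z := by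
    intro z hz
    have h1 := ((dk z).const_mul m).div (hasDerivAt_id z) hz.ne'
    have h2 := ((hf z hz).sub (dg z)).add h1
    refine h2.congr_deriv ?_
    simp only [hr1, id]
    field_simp
    ring
  have rb : ∀ z, 0 < z → |r z| ≤ (C + |m| * κ) / z := by
    intro z hz
    refine (abs_add_le _ _).trans ?_
    rw [add_div]
    refine add_le_add (b1 z hz) ?_
    rw [abs_div, abs_mul, abs_of_pos hz]
    gcongr
    exact kb z
  have r1b : ∀ z, 0 < z → |r1 z| ≤ C / z ^ 2 := b2
  set D1 := C * C + |m| * κ * κ + 2 * (κ * C) with hD1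
  set D2 := |m| * κ * κ + 2 * (κ * (C + |m| * κ)) with hD2
  refine ⟨D1 + D2, by positivity, fun t x y ht hx hy => ?_⟩
  set F : ℝ → ℝ := fun s => f (x * s) * f (y * s) - g (x * s) * g (y * s) with hF
  set B : ℝ → ℝ := fun s => -(m / (x * y)) * (k (x * s) * k (y * s) / s)
    + k (x * s) * r (y * s) / x + k (y * s) * r (x * s) / y with hB
  set B1 : ℝ → ℝ := fun s => -(m / (x * y)) * ((x * g (x * s) * k (y * s) + y * k (x * s) * g (y * s)) / s
      - k (x * s) * k (y * s) / s ^ 2)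
    + (x * g (x * s) * r (y * s) + k (x * s) * (y * r1 (y * s))) / x
    + (y * g (y * s) * r (x * s) + k (y * s) * (x * r1 (x * s))) / y with hB1
  set R : ℝ → ℝ := fun s => F s - B1 s with hR
  have dB : ∀ s, 0 < s → HasDerivAt B (B1 s) s := by
    intro s hs
    have hxs : HasDerivAt (fun s : ℝ => x * s) x s := by simpa using (hasDerivAt_id s).const_mul x
    have hys : HasDerivAt (fun s : ℝ => y * s) y s := by simpa using (hasDerivAt_id s).const_mul y
    have kx : HasDerivAt (fun s => k (x * s)) (g (x * s) * x) s := (dk (x * s)).comp s hxs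
    have ky : HasDerivAt (fun s => k (y * s)) (g (y * s) * y) s := (dk (y * s)).comp s hys
    have rx : HasDerivAt (fun s => r (x * s)) (r1 (x * s) * x) s := (dr (x * s) (by positivity)).comp s hxs
    have ry : HasDerivAt (fun s => r (y * s)) (r1 (y * s) * y) s := (dr (y * s) (by positivity)).comp s hys
    have h := ((((kx.mul ky).div (hasDerivAt_id s) hs.ne').const_mul (-(m / (x * y)))).add
      ((kx.mul ry).div_const x)).add ((ky.mul rx).div_const y)
    refine h.congr_deriv ?_
    simp only [hB1, id, Pi.mul_apply]
    field_simp
  have mx : ∀ {u : ℝ}, 0 < u → MapsTo (fun s : ℝ => u * s) (Ioi 0) (Ioi 0) := fun hu s hs => mul_pos hu hs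
  have cg : Continuous g := by fun_prop
  have ck : Continuous k := by fun_prop
  have cf : ContinuousOn f (Ioi 0) := fun z hz => (hf z hz).continuousAt.continuousWithinAt
  have cr : ContinuousOn r (Ioi 0) := fun z hz => (dr z hz).continuousAt.continuousWithinAt
  have cr1 : ContinuousOn r1 (Ioi 0) := by
    refine ((hf1.add ck.continuousOn).add ((continuousOn_const.mul cg.continuousOn).div continuousOn_id ?_)).sub
      ((continuousOn_const.mul ck.continuousOn).div (continuousOn_id.pow 2) ?_)
    · intro z hz; exact ne_of_gt hz
    · intro z hz; exact pow_ne_zero 2 (ne_of_gt hz)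
  have comp : ∀ {q : ℝ → ℝ} {u : ℝ}, 0 < u → ContinuousOn q (Ioi 0) → ContinuousOn (fun s => q (u * s)) (Ioi 0) :=
    fun hu hq => hq.comp (by fun_prop) (mx hu)
  have fx := comp hx cf
  have fy := comp hy cf
  have rx := comp hx cr
  have ry := comp hy cr
  have r1x := comp hx cr1
  have r1y := comp hy cr1
  have cF : ContinuousOn F (Ioi 0) := by
    refine (fx.mul fy).sub (Continuous.continuousOn ?_)
    fun_prop
  have cB1 : ContinuousOn B1 (Ioi 0) := by
    have gx : ContinuousOn (fun s => g (x * s)) (Ioi 0) := by fun_prop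
    have gy : ContinuousOn (fun s => g (y * s)) (Ioi 0) := by fun_prop
    have kx : ContinuousOn (fun s => k (x * s)) (Ioi 0) := by fun_prop
    have ky : ContinuousOn (fun s => k (y * s)) (Ioi 0) := by fun_prop
    have n1 : ∀ s ∈ Ioi (0:ℝ), s ≠ 0 := fun s hs => ne_of_gt hs
    have n2 : ∀ s ∈ Ioi (0:ℝ), s ^ 2 ≠ 0 := fun s hs => pow_ne_zero 2 (ne_of_gt hs)
    have c1 : ContinuousOn (fun s => (x * g (x * s) * k (y * s) + y * k (x * s) * g (y * s)) / s) (Ioi 0) :=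
      ContinuousOn.div (by fun_prop) continuousOn_id n1
    have c2 : ContinuousOn (fun s => k (x * s) * k (y * s) / s ^ 2) (Ioi 0) :=
      ContinuousOn.div (by fun_prop) (continuousOn_id.pow 2) n2
    have c3 : ContinuousOn (fun s => (x * g (x * s) * r (y * s) + k (x * s) * (y * r1 (y * s))) / x) (Ioi 0) :=
      ContinuousOn.div_const (((continuousOn_const.mul gx).mul ry).add (kx.mul (continuousOn_const.mul r1y))) _
    have c4 : ContinuousOn (fun s => (y * g (y * s) * r (x * s) + k (y * s) * (x * r1 (x * s))) / y) (Ioi 0) :=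
      ContinuousOn.div_const (((continuousOn_const.mul gy).mul rx).add (ky.mul (continuousOn_const.mul r1x))) _
    exact ((continuousOn_const.mul (c1.sub c2)).add c3).add c4
  have cR : ContinuousOn R (Ioi 0) := cF.sub cB1
  have Rb : ∀ s, 0 < s → |R s| ≤ D1 / (x * y) * s ^ (-2 : ℝ) := by
    intro s hs
    have hxs : 0 < x * s := by positivity
    have hys : 0 < y * s := by positivity
    have e : R s = (f (x * s) - g (x * s)) * (f (y * s) - g (y * s)) - m * (k (x * s) * k (y * s)) / (x * y * s ^ 2)
        - y / x * (k (x * s) * r1 (y * s)) - x / y * (k (y * s) * r1 (x * s)) := by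
      simp only [hR, hF, hB1, hr]
      generalize r1 (x * s) = A1
      generalize r1 (y * s) = A2
      generalize f (x * s) = A3
      generalize f (y * s) = A4
      generalize g (x * s) = A5
      generalize g (y * s) = A6
      generalize k (x * s) = A7
      generalize k (y * s) = A8
      field_simp
      ring
    have t1 : |(f (x * s) - g (x * s)) * (f (y * s) - g (y * s))| ≤ C * C / (x * y * s ^ 2) := by
      rw [abs_mul]
      calc _ ≤ C / (x * s) * (C / (y * s)) := by
            gcongr
            · exact b1 _ hxs
            · exact b1 _ hys
        _ = _ := by field_simp
    have t2 : |m * (k (x * s) * k (y * s)) / (x * y * s ^ 2)| ≤ |m| * κ * κ / (x * y * s ^ 2) := by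
      rw [abs_div, abs_mul, abs_mul, abs_of_pos (by positivity : 0 < x * y * s ^ 2), mul_assoc |m|]
      gcongr
      · exact kb _
      · exact kb _
    have t3 : |y / x * (k (x * s) * r1 (y * s))| ≤ κ * C / (x * y * s ^ 2) := by
      rw [abs_mul, abs_mul, abs_of_pos (by positivity : 0 < y / x)]
      calc _ ≤ y / x * (κ * (C / (y * s) ^ 2)) := by
            gcongr
            · exact kb _
            · exact r1b _ hys
        _ = _ := by field_simp
    have t4 : |x / y * (k (y * s) * r1 (x * s))| ≤ κ * C / (x * y * s ^ 2) := by
      rw [abs_mul, abs_mul, abs_of_pos (by positivity : 0 < x / y)]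
      calc _ ≤ x / y * (κ * (C / (x * s) ^ 2)) := by
            gcongr
            · exact kb _
            · exact r1b _ hxs
        _ = _ := by field_simp
    have e2 : D1 / (x * y) * s ^ (-2 : ℝ) = C * C / (x * y * s ^ 2) + |m| * κ * κ / (x * y * s ^ 2)
        + κ * C / (x * y * s ^ 2) + κ * C / (x * y * s ^ 2) := by
      rw [Real.rpow_neg hs.le, Real.rpow_two, hD1]
      field_simp
      ring
    rw [e, e2]
    refine (abs_sub _ _).trans (add_le_add ((abs_sub _ _).trans (add_le_add ((abs_sub _ _).trans (add_le_add t1 t2)) t3)) t4)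
  have Bb : ∀ s, 0 < s → |B s| ≤ D2 / (x * y * s) := by
    intro s hs
    have hxs : 0 < x * s := by positivity
    have hys : 0 < y * s := by positivity
    have t1 : |-(m / (x * y)) * (k (x * s) * k (y * s) / s)| ≤ |m| * κ * κ / (x * y * s) := by
      rw [abs_mul, abs_neg, abs_div, abs_div, abs_of_pos (by positivity : 0 < x * y), abs_mul, abs_of_pos hs]
      calc _ ≤ |m| / (x * y) * (κ * κ / s) := by
            gcongr
            · exact kb _
            · exact kb _
        _ = _ := by field_simp
    have t2 : |k (x * s) * r (y * s) / x| ≤ κ * (C + |m| * κ) / (x * y * s) := by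
      rw [abs_div, abs_mul, abs_of_pos hx]
      calc _ ≤ κ * ((C + |m| * κ) / (y * s)) / x := by
            gcongr
            · exact kb _
            · exact rb _ hys
        _ = _ := by field_simp
    have t3 : |k (y * s) * r (x * s) / y| ≤ κ * (C + |m| * κ) / (x * y * s) := by
      rw [abs_div, abs_mul, abs_of_pos hy]
      calc _ ≤ κ * ((C + |m| * κ) / (x * s)) / y := by
            gcongr
            · exact kb _
            · exact rb _ hxs
        _ = _ := by field_simp
    have e2 : D2 / (x * y * s) = |m| * κ * κ / (x * y * s) + κ * (C + |m| * κ) / (x * y * s)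
        + κ * (C + |m| * κ) / (x * y * s) := by
      rw [hD2]; ring
    rw [e2]
    exact (abs_add_le _ _).trans (add_le_add ((abs_add_le _ _).trans (add_le_add t1 t2)) t3)
  have hsub : Ioi t ⊆ Ioi 0 := Ioi_subset_Ioi ht.le
  have ip : IntegrableOn (fun s : ℝ => D1 / (x * y) * s ^ (-2 : ℝ)) (Ioi t) :=
    (integrableOn_Ioi_rpow_of_lt (by norm_num) ht).const_mul _
  have hRle : ∀ᵐ s ∂(volume.restrict (Ioi t)), ‖R s‖ ≤ D1 / (x * y) * s ^ (-2 : ℝ) := by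
    refine (ae_restrict_iff' measurableSet_Ioi).2 (Eventually.of_forall fun s hs => ?_)
    exact Rb s (hsub hs)
  have iR : IntegrableOn R (Ioi t) :=
    Integrable.mono' ip ((cR.mono hsub).aestronglyMeasurable measurableSet_Ioi) hRle
  have nR : ‖∫ s in Ioi t, R s‖ ≤ D1 / (x * y * t) := by
    refine (norm_integral_le_of_norm_le ip hRle).trans (le_of_eq ?_)
    rw [integral_const_mul, integral_Ioi_rpow_of_lt (by norm_num) ht]
    rw [show (-2 : ℝ) + 1 = -1 by norm_num, Real.rpow_neg_one]
    field_simp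
  refine ⟨0 - B t + ∫ s in Ioi t, R s, ?_, ?_⟩
  · rw [zero_sub]
    refine (abs_add_le _ _).trans ?_
    rw [abs_neg, add_div, add_comm]
    exact add_le_add nR (Bb t ht)
  · have hB0 : Tendsto B atTop (nhds 0) := by
      have hz : Tendsto (fun s : ℝ => D2 / (x * y * s)) atTop (nhds 0) :=
        (tendsto_id.const_mul_atTop (by positivity : 0 < x * y)).const_div_atTop D2
      refine squeeze_zero_norm' ?_ hz
      filter_upwards [eventually_gt_atTop 0] with s hs using Bb s hs
    have hlim := (hB0.sub_const (B t)).add (intervalIntegral_tendsto_integral_Ioi t iR tendsto_id)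
    refine hlim.congr' ?_
    filter_upwards [eventually_ge_atTop t] with S hS
    have hss : uIcc t S ⊆ Ioi 0 := by
      rw [uIcc_of_le hS]
      intro s hs
      exact lt_of_lt_of_le ht hs.1
    have iB1 : IntervalIntegrable B1 volume t S := (cB1.mono hss).intervalIntegrable
    have iRR : IntervalIntegrable R volume t S := (cR.mono hss).intervalIntegrable
    have h1 := intervalIntegral.integral_eq_sub_of_hasDerivAt (fun s hs => dB s (hss hs)) iB1
    rw [← h1, id, ← intervalIntegral.integral_add iB1 iRR]
    refine intervalIntegral.integral_congr fun s _ => ?_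
    simp only [hR, hF]
    ring
lemma inv_sq_lint : ∫⁻ x in Ici (1:ℝ), ENNReal.ofReal (x ^ (-2 : ℝ)) = 1 := by
  rw [setLIntegral_congr (Ioi_ae_eq_Ici).symm, ← ofReal_integral_eq_lintegral_ofReal
    (integrableOn_Ioi_rpow_of_lt (by norm_num) one_pos)]
  · rw [integral_Ioi_rpow_of_lt (by norm_num) one_pos]
    norm_num
  · refine (ae_restrict_iff' measurableSet_Ioi).2 (Eventually.of_forall fun s hs => ?_)
    have : (0:ℝ) < s := lt_trans one_pos hs
    simp only [Pi.zero_apply]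
    positivity

lemma L2_of_pointwise (K : ℝ → ℝ → ℝ) (E : ℝ) (h : ∀ x : ℝ, 1 ≤ x → ∀ y : ℝ, 1 ≤ y → |K x y| ≤ E / (x * y)) :
    (∫⁻ p in (Set.Ici (1 : ℝ) ×ˢ Set.Ici (1 : ℝ)), ENNReal.ofReal ((K p.1 p.2) ^ 2)) ≤ ENNReal.ofReal (E ^ 2) := by
  calc _ ≤ ∫⁻ p in (Set.Ici (1 : ℝ) ×ˢ Set.Ici (1 : ℝ)),
        ENNReal.ofReal (E ^ 2) * (ENNReal.ofReal (p.1 ^ (-2 : ℝ)) * ENNReal.ofReal (p.2 ^ (-2 : ℝ))) := by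
        refine setLIntegral_mono' (measurableSet_Ici.prod measurableSet_Ici) fun p hp => ?_
        obtain ⟨h1, h2⟩ := hp
        have h1' : (0:ℝ) < p.1 := lt_of_lt_of_le one_pos h1
        have h2' : (0:ℝ) < p.2 := lt_of_lt_of_le one_pos h2
        rw [← ENNReal.ofReal_mul (by positivity), ← ENNReal.ofReal_mul (by positivity)]
        refine ENNReal.ofReal_le_ofReal ?_
        have h3 := h p.1 h1 p.2 h2
        rw [Real.rpow_neg h1'.le, Real.rpow_neg h2'.le, Real.rpow_two, Real.rpow_two, ← sq_abs]
        calc _ ≤ (E / (p.1 * p.2)) ^ 2 := by gcongr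
          _ = _ := by field_simp
    _ = ENNReal.ofReal (E ^ 2) := by
        have m1 : Measurable fun x : ℝ => ENNReal.ofReal (x ^ (-2 : ℝ)) := by fun_prop
        rw [lintegral_const_mul _ (by fun_prop), Measure.volume_eq_prod, ← Measure.prod_restrict,
          lintegral_prod_mul m1.aemeasurable m1.aemeasurable, inv_sq_lint, one_mul, mul_one]

lemma integrand_eq (ν x y s : ℝ) (hx : 0 < x) (hy : 0 < y) (hs : 0 < s) :
    s * Real.sqrt (x * y) * besselJ ν (x * s) * besselJ ν (y * s) -
        2 * Real.cos (x * s - (Real.pi * ν / 2 + Real.pi / 4)) *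
          Real.cos (y * s - (Real.pi * ν / 2 + Real.pi / 4)) / Real.pi =
    fB ν (x * s) * fB ν (y * s) - kap * Real.cos (x * s - alp ν) * (kap * Real.cos (y * s - alp ν)) := by
  rw [← fB_eq ν (x * s) (by positivity), ← fB_eq ν (y * s) (by positivity), Real.sqrt_mul hx.le, Real.sqrt_mul hx.le,
    Real.sqrt_mul hy.le]
  have h1 : Real.sqrt s * Real.sqrt s = s := Real.mul_self_sqrt hs.le
  have h2 : kap * kap = 2 / Real.pi := Real.mul_self_sqrt (by positivity)
  unfold alp
  set c := Real.cos (x * s - (Real.pi * ν / 2 + Real.pi / 4))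
  set d := Real.cos (y * s - (Real.pi * ν / 2 + Real.pi / 4))
  linear_combination (-(Real.sqrt x * Real.sqrt y * besselJ ν (x * s) * besselJ ν (y * s))) * h1 + c * d * h2

/-- For `ν > -1` there is a constant `C_ν` such that for all `t > 0`:
`K_t(x,y) = O(1/(xyt))` uniformly for `x, y ≥ 1`, and consequently
`(∫_1^∞ ∫_1^∞ |K_t(x,y)|² dx dy)^{1/2} ≤ C_ν / t`. -/
theorem besselTailKernel_L2_estimate
    (ν : ℝ) (hν : -1 < ν) :
    ∃ C : ℝ, 0 ≤ C ∧ ∀ t : ℝ, 0 < t →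
      (∀ x : ℝ, 1 ≤ x → ∀ y : ℝ, 1 ≤ y →
        |besselTailKernel ν t x y| ≤ C / (x * y * t)) ∧
      (∫⁻ p in (Set.Ici (1 : ℝ) ×ˢ Set.Ici (1 : ℝ)),
          ENNReal.ofReal ((besselTailKernel ν t p.1 p.2) ^ 2))
        ≤ ENNReal.ofReal ((C / t) ^ 2) := by
  obtain ⟨C, hC, hb⟩ := main_bounds ν hν
  obtain ⟨D, hD, hK⟩ := kernel_bound (fB ν) (fB1 ν) kap (alp ν) ((ν ^ 2 - 1 / 4) / 2) C kap_pos hC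
    (fun z hz => hasDerivAt_fB ν z hν hz)
    (fun z hz => (hasDerivAt_fB1 ν z hν hz).continuousAt.continuousWithinAt)
    (fun z hz => (hb z hz).1) (fun z hz => (hb z hz).2)
  refine ⟨D, hD, fun t ht => ?_⟩
  have key : ∀ x : ℝ, 1 ≤ x → ∀ y : ℝ, 1 ≤ y → |besselTailKernel ν t x y| ≤ D / (x * y * t) := by
    intro x hx y hy
    have hx0 : 0 < x := by linarith
    have hy0 : 0 < y := by linarith
    obtain ⟨L, hL, hlim⟩ := hK t x y ht hx0 hy0
    have : besselTailKernel ν t x y = L := by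
      unfold besselTailKernel
      refine Tendsto.limUnder_eq (hlim.congr' ?_)
      filter_upwards [eventually_ge_atTop t] with S hS
      refine intervalIntegral.integral_congr fun s hs => ?_
      rw [uIcc_of_le hS] at hs
      exact (integrand_eq ν x y s hx0 hy0 (lt_of_lt_of_le ht hs.1)).symm
    rw [this]
    exact hL
  refine ⟨key, L2_of_pointwise (besselTailKernel ν t) (D / t) fun x hx y hy => ?_⟩
  refine (key x hx y hy).trans (le_of_eq ?_)
  rw [div_div, mul_comm t]

end
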